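/- arXiv:2512.09129 — 4 statements merged into one kernel-verified Lean document; each statement's English description precedes it below -/
import Mathlib

section
/- Let σ ∈ (0,1), u(q) = q^σ/σ, and α ∈ [0,1]. For every mechanism t, the infimum over all cost functions c ∈ C_cx of the weighted regulator surplus ratio (U(c,t) + α·Π(c,t))/W(c) is at most B_α(σ); moreover this infimum equals B_α(σ) if and only if t(q) = z_α*·u(q) for all q. -/
open Real Set

noncomputable section

/-- `q` is the smallest maximizer of `f` on the set `s`. -/
def IsSmallestArgmaxOn (f : ℝ → ℝ) (s : Set ℝ) (q : ℝ) : Prop :=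
  q ∈ s ∧ (∀ x ∈ s, f x ≤ f q) ∧ ∀ x ∈ s, (∀ y ∈ s, f y ≤ f x) → q ≤ x

/-- The class `C_cx` of admissible cost functions: nonnegative on `[0,∞)`, nondecreasing,
convex, vanishing at `0`, and not identically zero. -/
def CostCcx (c : ℝ → ℝ) : Prop :=
  (∀ q ≥ (0:ℝ), 0 ≤ c q) ∧ MonotoneOn c (Ici 0) ∧ ConvexOn ℝ (Ici 0) c ∧
    c 0 = 0 ∧ ∃ q ≥ (0:ℝ), c q ≠ 0

open Filter Topology

/-- The isoelastic utility `q ^ σ / σ`. -/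
def util (σ q : ℝ) : ℝ := q ^ σ / σ

/-- The denominator of `ψ`: normalized efficient surplus against a kinked cost whose slope is
`y` times the marginal utility at the kink. -/
def kinkSurplus (σ y : ℝ) : ℝ := (1 - σ) * y ^ (-(σ / (1 - σ))) + σ * y

/-- The cost that vanishes up to `m` and has slope `k` afterwards. -/
def kink (m k q : ℝ) : ℝ := k * max (q - m) 0

lemma kink_of_le {m k q : ℝ} (h : q ≤ m) : kink m k q = 0 := by
  simp [kink, max_eq_right (sub_nonpos.2 h)]

lemma kink_of_ge {m k q : ℝ} (h : m ≤ q) : kink m k q = k * (q - m) := by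
  simp [kink, max_eq_left (sub_nonneg.2 h)]

lemma le_kink {m k q : ℝ} (hk : 0 ≤ k) : k * (q - m) ≤ kink m k q :=
  mul_le_mul_of_nonneg_left (le_max_left _ _) hk

lemma costCcx_kink {m k : ℝ} (hm : 0 ≤ m) (hk : 0 < k) : CostCcx (kink m k) := by
  refine ⟨fun q _ => by unfold kink; positivity, fun a _ b _ hab => ?_, ?_, kink_of_le hm,
    m + 1, by positivity, ?_⟩
  · unfold kink
    gcongr
  · refine ⟨convex_Ici 0, fun x _ y _ a b ha hb hab => ?_⟩
    simp only [kink, smul_eq_mul]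
    have h : max (a * x + b * y - m) 0 ≤ a * max (x - m) 0 + b * max (y - m) 0 := by
      refine max_le ?_ (by positivity)
      have h1 := mul_le_mul_of_nonneg_left (le_max_left (x - m) 0) ha
      have h2 := mul_le_mul_of_nonneg_left (le_max_left (y - m) 0) hb
      have h3 : (a + b) * m = m := by rw [hab, one_mul]
      linarith
    have := mul_le_mul_of_nonneg_left h hk.le
    linarith
  · rw [kink_of_ge (by linarith)]
    simp [hk.ne']

section Utility

variable {σ : ℝ}

lemma rpow_le_affine (hσ : σ ∈ Ioo (0:ℝ) 1) {x : ℝ} (hx : 0 ≤ x) : x ^ σ ≤ 1 - σ + σ * x := by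
  have := rpow_one_add_le_one_add_mul_self (s := x - 1) (by linarith) hσ.1.le hσ.2.le
  rw [add_sub_cancel] at this
  linarith

lemma rpow_lt_affine (hσ : σ ∈ Ioo (0:ℝ) 1) {x : ℝ} (hx : 0 ≤ x) (h1 : x ≠ 1) :
    x ^ σ < 1 - σ + σ * x := by
  have := rpow_one_add_lt_one_add_mul_self (s := x - 1) (by linarith) (sub_ne_zero.2 h1)
    hσ.1 hσ.2
  rw [add_sub_cancel] at this
  linarith

lemma util_zero (hσ : σ ∈ Ioo (0:ℝ) 1) : util σ 0 = 0 := by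
  simp [util, zero_rpow hσ.1.ne']

lemma util_pos (hσ : σ ∈ Ioo (0:ℝ) 1) {q : ℝ} (hq : 0 < q) : 0 < util σ q :=
  div_pos (rpow_pos_of_pos hq _) hσ.1

lemma util_nonneg (hσ : σ ∈ Ioo (0:ℝ) 1) {q : ℝ} (hq : 0 ≤ q) : 0 ≤ util σ q :=
  div_nonneg (rpow_nonneg hq _) hσ.1.le

lemma util_le (hσ : σ ∈ Ioo (0:ℝ) 1) {p q : ℝ} (hp : 0 ≤ p) (h : p ≤ q) :
    util σ p ≤ util σ q :=
  div_le_div_of_nonneg_right (rpow_le_rpow hp h hσ.1.le) hσ.1.le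

lemma util_lt (hσ : σ ∈ Ioo (0:ℝ) 1) {p q : ℝ} (hp : 0 ≤ p) (h : p < q) :
    util σ p < util σ q :=
  div_lt_div_of_pos_right (rpow_lt_rpow hp h hσ.1) hσ.1

lemma continuous_util (hσ : σ ∈ Ioo (0:ℝ) 1) : Continuous (util σ) :=
  (continuous_rpow_const hσ.1.le).div_const _

lemma util_mul {a b : ℝ} (ha : 0 ≤ a) (hb : 0 ≤ b) :
    util σ (a * b) = a ^ σ * util σ b := by
  rw [util, util, mul_rpow ha hb, mul_div_assoc]

lemma rpow_sub_one_mul_self {m : ℝ} (hm : 0 < m) : m ^ (σ - 1) * m = m ^ σ := by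
  rw [rpow_sub_one hm.ne', div_mul_cancel₀ _ hm.ne']

lemma mul_util (hσ : σ ∈ Ioo (0:ℝ) 1) (m : ℝ) : σ * util σ m = m ^ σ :=
  mul_div_cancel₀ _ hσ.1.ne'

lemma rpow_sub_le_kinkSurplus (hσ : σ ∈ Ioo (0:ℝ) 1) {x y : ℝ} (hx : 0 ≤ x) (hy : 0 < y) :
    x ^ σ - y * σ * (x - 1) ≤ kinkSurplus σ y := by
  have h1 : (1 - σ) ≠ 0 := by linarith [hσ.2]
  set x₁ := y ^ (-(1 / (1 - σ))) with hx₁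
  have hpos : 0 < x₁ := rpow_pos_of_pos hy _
  have hs : x₁ ^ σ = y ^ (-(σ / (1 - σ))) := by
    rw [hx₁, ← rpow_mul hy.le]; congr 1; ring
  have hd : x₁ ^ (σ - 1) = y := by
    rw [hx₁, ← rpow_mul hy.le]
    convert rpow_one y using 2
    field_simp
    ring
  have hb := rpow_le_affine hσ (x := x / x₁) (by positivity)
  rw [div_rpow hx hpos.le, div_le_iff₀ (by positivity)] at hb
  have h2 : (1 - σ + σ * (x / x₁)) * x₁ ^ σ = (1 - σ) * x₁ ^ σ + σ * x * x₁ ^ (σ - 1) := by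
    rw [rpow_sub_one hpos.ne']; field_simp
  rw [h2, hs, hd] at hb
  unfold kinkSurplus
  linarith

lemma exists_rpow_sub_eq_kinkSurplus (hσ : σ ∈ Ioo (0:ℝ) 1) {y : ℝ} (hy : 0 < y) (hy1 : y ≤ 1) :
    ∃ x ≥ (1:ℝ), x ^ σ - y * σ * (x - 1) = kinkSurplus σ y := by
  have h1 : 0 < 1 - σ := by linarith [hσ.2]
  refine ⟨y ^ (-(1 / (1 - σ))), one_le_rpow_of_pos_of_le_one_of_nonpos hy hy1 (by
    rw [neg_nonpos]; positivity), ?_⟩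
  have hs : (y ^ (-(1 / (1 - σ)))) ^ σ = y ^ (-(σ / (1 - σ))) := by
    rw [← rpow_mul hy.le]; congr 1; ring
  have hd : y * y ^ (-(1 / (1 - σ))) = y ^ (-(σ / (1 - σ))) := by
    nth_rewrite 1 [← rpow_one y]
    rw [← rpow_add hy]
    congr 1
    field_simp
    ring
  have : y * σ * (y ^ (-(1 / (1 - σ))) - 1) = σ * (y * y ^ (-(1 / (1 - σ)))) - σ * y := by ring
  rw [hs, this, hd]
  unfold kinkSurplus
  ring

lemma util_sub_scale (hσ : σ ∈ Ioo (0:ℝ) 1) {m x y : ℝ} (hm : 0 < m) (hx : 0 ≤ x) :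
    util σ (m * x) - y * m ^ (σ - 1) * (m * x - m) =
      (x ^ σ - y * σ * (x - 1)) * util σ m := by
  have h1 : y * m ^ (σ - 1) * (m * x - m) = y * (m ^ (σ - 1) * m) * (x - 1) := by ring
  rw [h1, rpow_sub_one_mul_self hm, ← mul_util hσ m, mul_comm m x, util_mul hx hm.le]
  ring

lemma util_sub_le (hσ : σ ∈ Ioo (0:ℝ) 1) {m q y : ℝ} (hm : 0 < m) (hq : 0 ≤ q) (hy : 0 < y) :
    util σ q - y * m ^ (σ - 1) * (q - m) ≤ kinkSurplus σ y * util σ m := by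
  have h := util_sub_scale hσ (y := y) hm (div_nonneg hq hm.le)
  rw [mul_div_cancel₀ _ hm.ne'] at h
  rw [h]
  exact mul_le_mul_of_nonneg_right (rpow_sub_le_kinkSurplus hσ (div_nonneg hq hm.le) hy)
    (util_nonneg hσ hm.le)

lemma kinkSurplus_one : kinkSurplus σ 1 = 1 := by
  simp [kinkSurplus]

lemma util_le_tangent (hσ : σ ∈ Ioo (0:ℝ) 1) {m q : ℝ} (hm : 0 < m) (hq : 0 ≤ q) :
    util σ q ≤ util σ m + m ^ (σ - 1) * (q - m) := by
  have := util_sub_le hσ hm hq one_pos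
  rw [kinkSurplus_one] at this
  linarith

lemma kinkSurplus_pos (hσ : σ ∈ Ioo (0:ℝ) 1) {y : ℝ} (hy : 0 < y) : 0 < kinkSurplus σ y := by
  have h1 : 0 < 1 - σ := by linarith [hσ.2]
  have := hσ.1
  unfold kinkSurplus
  positivity

lemma isLUB_kink_surplus (hσ : σ ∈ Ioo (0:ℝ) 1) {m y : ℝ} (hm : 0 < m) (hy : 0 < y)
    (hy1 : y ≤ 1) :
    IsLUB {x | ∃ q ≥ (0:ℝ), x = util σ q - kink m (y * m ^ (σ - 1)) q}
      (kinkSurplus σ y * util σ m) := by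
  have hk : 0 ≤ y * m ^ (σ - 1) := by positivity
  refine IsGreatest.isLUB ⟨?_, ?_⟩
  · obtain ⟨x, hx, h⟩ := exists_rpow_sub_eq_kinkSurplus hσ hy hy1
    refine ⟨m * x, by positivity, ?_⟩
    rw [kink_of_ge (by nlinarith), util_sub_scale hσ hm (by linarith), h]
  · rintro _ ⟨q, hq, rfl⟩
    have := util_sub_le hσ hm hq hy
    have := le_kink (m := m) (q := q) hk
    linarith

lemma hasDerivAt_kinkSurplus (hσ : σ ∈ Ioo (0:ℝ) 1) {y : ℝ} (hy : 0 < y) :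
    HasDerivAt (kinkSurplus σ) (σ * (1 - y ^ (-(1 / (1 - σ))))) y := by
  have h1 : (1 - σ) ≠ 0 := by linarith [hσ.2]
  have h := ((hasDerivAt_rpow_const (x := y) (p := -(σ / (1 - σ))) (Or.inl hy.ne')).const_mul
    (1 - σ)).add ((hasDerivAt_id y).const_mul σ)
  have he : -(σ / (1 - σ)) - 1 = -(1 / (1 - σ)) := by field_simp; ring
  rw [he] at h
  refine HasDerivAt.congr_deriv (show HasDerivAt (kinkSurplus σ) _ y from h) ?_
  have : (1 - σ) * (-(σ / (1 - σ)) * y ^ (-(1 / (1 - σ)))) = -σ * y ^ (-(1 / (1 - σ))) := by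
    rw [← mul_assoc, mul_neg, mul_div_cancel₀ _ h1]
  rw [this]
  ring

lemma strictAntiOn_kinkSurplus (hσ : σ ∈ Ioo (0:ℝ) 1) :
    StrictAntiOn (kinkSurplus σ) (Ioc 0 1) := by
  refine strictAntiOn_of_deriv_neg (convex_Ioc 0 1)
    (fun y hy => (hasDerivAt_kinkSurplus hσ hy.1).continuousAt.continuousWithinAt)
    fun y hy => ?_
  rw [interior_Ioc] at hy
  rw [(hasDerivAt_kinkSurplus hσ hy.1).deriv]
  have h1 : 0 < 1 - σ := by linarith [hσ.2]
  have : 1 < y ^ (-(1 / (1 - σ))) :=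
    one_lt_rpow_of_pos_of_lt_one_of_neg hy.1 hy.2 (by rw [neg_lt_zero]; positivity)
  exact mul_neg_of_pos_of_neg hσ.1 (by linarith)

end Utility

/-- The conditions on the parameters: `B` is the maximal value of
`z ↦ (1 - (1 - α) z) / kinkSurplus σ z` on `(0, 1)` and `z₀` is the only maximizer. -/
structure IsOptimalShare (σ α z₀ B : ℝ) : Prop where
  mem_share : z₀ ∈ Ioo (0:ℝ) 1
  eq_mul : 1 - (1 - α) * z₀ = B * kinkSurplus σ z₀
  lt_mul : ∀ z ∈ Ioo (0:ℝ) 1, z ≠ z₀ → 1 - (1 - α) * z < B * kinkSurplus σ z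

namespace IsOptimalShare

variable {σ α z₀ B : ℝ}

lemma pos (h : IsOptimalShare σ α z₀ B) (hσ : σ ∈ Ioo (0:ℝ) 1) (hα : α ∈ Icc (0:ℝ) 1) :
    0 < B := by
  have h1 := h.eq_mul
  have h2 := h.mem_share
  have h3 : 0 < 1 - (1 - α) * z₀ := by nlinarith [hα.1, h2.1, h2.2]
  rw [h1] at h3
  exact pos_of_mul_pos_left h3 (kinkSurplus_pos hσ h2.1).le

lemma weight_lt_one (h : IsOptimalShare σ α z₀ B) (hσ : σ ∈ Ioo (0:ℝ) 1)
    (hα : α ∈ Icc (0:ℝ) 1) : α < 1 := by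
  refine lt_of_le_of_ne hα.2 ?_
  rintro rfl
  obtain ⟨h0, h1⟩ := h.mem_share
  have hz : (z₀ + 1) / 2 ∈ Ioo (0:ℝ) 1 := ⟨by linarith, by linarith⟩
  have h2 := h.lt_mul _ hz (by linarith)
  have h3 := strictAntiOn_kinkSurplus hσ ⟨h0, h1.le⟩ (Ioo_subset_Ioc_self hz) (by linarith)
  have h4 := h.eq_mul
  have h5 := mul_lt_mul_of_pos_left h3 (h.pos hσ hα)
  linarith

lemma weight_lt (h : IsOptimalShare σ α z₀ B) (hσ : σ ∈ Ioo (0:ℝ) 1)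
    (hα : α ∈ Icc (0:ℝ) 1) : α < B := by
  have hα1 := h.weight_lt_one hσ hα
  have hd : HasDerivAt (fun z => (1 - (1 - α) * z) - α * kinkSurplus σ z) (-(1 - α)) 1 := by
    have h1 := (((hasDerivAt_id (1:ℝ)).const_mul (1 - α)).const_sub 1).sub
      ((hasDerivAt_kinkSurplus hσ one_pos).const_mul α)
    refine h1.congr_deriv ?_
    simp
  rw [hasDerivAt_iff_tendsto_slope] at hd
  have hlt := (hd.mono_left (nhdsLT_le_nhdsNE (1:ℝ))).eventually
    (gt_mem_nhds (show -(1 - α) < 0 by linarith))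
  obtain ⟨z, hz, hz01⟩ := (hlt.and (Ioo_mem_nhdsLT (zero_lt_one' ℝ))).exists
  rw [slope_def_field, div_neg_iff] at hz
  rw [kinkSurplus_one] at hz
  have hF : α * kinkSurplus σ z < 1 - (1 - α) * z := by
    rcases hz with hz | hz
    · linarith [hz.1]
    · linarith [hz.2, hz01.2]
  have hle : 1 - (1 - α) * z ≤ B * kinkSurplus σ z := by
    by_cases hzz : z = z₀
    · rw [hzz]; exact h.eq_mul.le
    · exact (h.lt_mul z hz01 hzz).le
  exact lt_of_mul_lt_mul_right (hF.trans_le hle) (kinkSurplus_pos hσ hz01.1).le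

lemma exists_gap (h : IsOptimalShare σ α z₀ B) (hσ : σ ∈ Ioo (0:ℝ) 1)
    (hα : α ∈ Icc (0:ℝ) 1) {L : ℝ} (hL : L ∈ Ico (0:ℝ) 1) (hne : L ≠ z₀) :
    ∃ δ > 0, L + δ ≤ 1 ∧ 1 - (1 - α) * (L - δ) < B * kinkSurplus σ (L + δ) := by
  have hB := h.pos hσ hα
  suffices hev : ∀ᶠ δ in 𝓝[>] (0:ℝ), 1 - (1 - α) * (L - δ) < B * kinkSurplus σ (L + δ) by
    obtain ⟨δ, h1, h2⟩ := (hev.and (Ioo_mem_nhdsGT (sub_pos.2 hL.2))).exists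
    exact ⟨δ, h2.1, by linarith [h2.2], h1⟩
  have hN : Tendsto (fun δ => 1 - (1 - α) * (L - δ)) (𝓝[>] 0) (𝓝 (1 - (1 - α) * L)) := by
    have : Continuous fun δ => 1 - (1 - α) * (L - δ) := by fun_prop
    simpa using (this.tendsto 0).mono_left nhdsWithin_le_nhds
  rcases hL.1.eq_or_lt with h0 | h0
  · subst h0
    have h1 : 0 < 1 - σ := by linarith [hσ.2]
    have hexp : -(σ / (1 - σ)) < 0 := neg_lt_zero.2 (div_pos hσ.1 h1)
    have hD : Tendsto (fun δ => B * ((1 - σ) * δ ^ (-(σ / (1 - σ))))) (𝓝[>] 0) atTop :=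
      ((tendsto_rpow_neg_nhdsGT_zero hexp).const_mul_atTop h1).const_mul_atTop hB
    filter_upwards [hN.eventually (gt_mem_nhds (show 1 - (1 - α) * 0 < 2 by norm_num)),
      hD.eventually_ge_atTop 2, self_mem_nhdsWithin] with δ h2 h3 h4
    refine h2.trans_le (h3.trans (mul_le_mul_of_nonneg_left ?_ hB.le))
    rw [zero_add, kinkSurplus]
    linarith [mul_pos hσ.1 (mem_Ioi.1 h4)]
  · have hc : ContinuousAt (fun δ => B * kinkSurplus σ (L + δ)) 0 := by
      refine continuousAt_const.mul (ContinuousAt.comp (g := kinkSurplus σ) ?_ (by fun_prop))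
      rw [add_zero]
      exact (hasDerivAt_kinkSurplus hσ h0).continuousAt
    refine hN.eventually_lt (hc.tendsto.mono_left nhdsWithin_le_nhds) ?_
    rw [add_zero]
    exact h.lt_mul L ⟨h0, hL.2⟩ hne

end IsOptimalShare

/-- `T` grows at least as fast as robustness forces the running maximum of a transfer to grow. -/
structure HasJumps (σ α B : ℝ) (T : ℝ → ℝ) : Prop where
  mono : MonotoneOn T (Ici 0)
  nonneg : ∀ q, 0 ≤ q → 0 ≤ T q
  jump : ∀ m > 0, ∀ y ∈ Ioc (0:ℝ) 1, ∀ l, 1 - (1 - α) * l < B * kinkSurplus σ y →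
    l * util σ m ≤ T m → ∃ Q > m, T m + y * m ^ (σ - 1) * (Q - m) ≤ T Q

namespace HasJumps

variable {σ α z₀ B : ℝ} {T : ℝ → ℝ}

lemma exists_jump_over (hT : HasJumps σ α B T) (hσ : σ ∈ Ioo (0:ℝ) 1) {y l m p : ℝ}
    (hy : y ∈ Ioc (0:ℝ) 1) (hly : l ≤ y) (hl : 1 - (1 - α) * l < B * kinkSurplus σ y)
    (hm : 0 < m) (hmT : l * util σ m ≤ T m) (hmp : m ≤ p) :
    ∃ s ∈ Icc m p, ∃ Q > p, T m - y * util σ m ≤ T s - y * util σ s ∧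
      T s + y * s ^ (σ - 1) * (Q - s) ≤ T Q := by
  set S := {q | q ∈ Icc m p ∧ T m - y * util σ m ≤ T q - y * util σ q}
  have hne : S.Nonempty := ⟨m, ⟨le_rfl, hmp⟩, le_rfl⟩
  have hbdd : BddAbove S := ⟨p, fun q hq => hq.1.2⟩
  have hms : m ≤ sSup S := le_csSup hbdd ⟨⟨le_rfl, hmp⟩, le_rfl⟩
  have hsp : sSup S ≤ p := csSup_le hne fun q hq => hq.1.2
  set s := sSup S
  have hs0 : 0 < s := hm.trans_le hms
  have hclosed : IsClosed {q | y * util σ q + (T m - y * util σ m) ≤ T s} :=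
    isClosed_le (((continuous_util hσ).const_mul y).add continuous_const) continuous_const
  have hsub : S ⊆ {q | y * util σ q + (T m - y * util σ m) ≤ T s} := fun q hq => by
    have := hT.mono (hm.le.trans hq.1.1) hs0.le (le_csSup hbdd hq)
    have := hq.2
    simp only [mem_ofPred_eq]
    linarith
  have hs : y * util σ s + (T m - y * util σ m) ≤ T s :=
    closure_minimal hsub hclosed (csSup_mem_closure hne hbdd)
  have hls : l * util σ s ≤ T s := by
    have := util_le hσ hm.le hms
    nlinarith
  obtain ⟨Q, hQ, hTQ⟩ := hT.jump s hs0 y hy l hl hls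
  refine ⟨s, ⟨hms, hsp⟩, Q, ?_, by linarith, hTQ⟩
  by_contra! hQp
  refine hQ.not_ge (le_csSup hbdd ⟨⟨hms.trans hQ.le, hQp⟩, ?_⟩)
  have := mul_le_mul_of_nonneg_left (util_le_tangent hσ hs0 (hs0.le.trans hQ.le)) hy.1.le
  linarith

lemma le_optimal (hT : HasJumps σ α B T) (hσ : σ ∈ Ioo (0:ℝ) 1) (hα : α ∈ Icc (0:ℝ) 1)
    (h : IsOptimalShare σ α z₀ B) {Z : ℝ} (hZ1 : Z < 1)
    (hZ : ∀ m > 0, T m ≤ Z * util σ m) {m : ℝ} (hm : 0 < m) : T m ≤ z₀ * util σ m := by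
  set S := {z | ∃ q > 0, z = T q / util σ q}
  have hne : S.Nonempty := ⟨_, 1, one_pos, rfl⟩
  have hub : ∀ z ∈ S, z ≤ Z := by
    rintro _ ⟨q, hq, rfl⟩
    exact (div_le_iff₀ (util_pos hσ hq)).2 (hZ q hq)
  have hbdd : BddAbove S := ⟨Z, hub⟩
  have hle : ∀ q > 0, T q ≤ sSup S * util σ q := fun q hq =>
    (div_le_iff₀ (util_pos hσ hq)).1 (le_csSup hbdd ⟨q, hq, rfl⟩)
  have hL : sSup S ∈ Ico (0:ℝ) 1 :=
    ⟨(div_nonneg (hT.nonneg 1 zero_le_one) (util_nonneg hσ zero_le_one)).trans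
      (le_csSup hbdd ⟨1, one_pos, rfl⟩), (csSup_le hne hub).trans_lt hZ1⟩
  suffices hZz : sSup S = z₀ by rw [← hZz]; exact hle m hm
  by_contra hZz
  obtain ⟨δ, hδ, hδ1, hgap⟩ := h.exists_gap hσ hα hL hZz
  obtain ⟨_, ⟨q, hq, rfl⟩, hqL⟩ := exists_lt_of_lt_csSup hne (sub_lt_self (sSup S) hδ)
  have hqT := ((lt_div_iff₀ (util_pos hσ hq)).1 hqL).le
  set y := sSup S + δ
  have hy : 0 < y := add_pos_of_nonneg_of_pos hL.1 hδ
  set C := (y * util σ q - T q) / δ with hC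
  set p := max q ((max C 0 * σ) ^ (1 / σ))
  have hup : C ≤ util σ p := by
    have h0 : 0 ≤ max C 0 * σ := mul_nonneg (le_max_right _ _) hσ.1.le
    have h1 := util_le hσ (rpow_nonneg h0 _) (le_max_right q ((max C 0 * σ) ^ (1 / σ)))
    rw [util, ← rpow_mul h0, one_div_mul_cancel hσ.1.ne', rpow_one,
      mul_div_cancel_right₀ _ hσ.1.ne'] at h1
    exact (le_max_left _ _).trans h1
  obtain ⟨s, hs, Q, hQ, hG, hTQ⟩ := hT.exists_jump_over hσ (p := p) ⟨hy, hδ1⟩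
    (by linarith) hgap hq hqT (le_max_left _ _)
  have hs0 : 0 < s := hq.trans_le hs.1
  have hQ0 : 0 < Q := (hs0.trans_le hs.2).trans hQ
  have h1 := mul_le_mul_of_nonneg_left (util_le_tangent hσ hs0 hQ0.le) hy.le
  have h2 := hle Q hQ0
  have h3 := util_lt hσ (hs0.trans_le hs.2).le hQ
  have h4 : δ * util σ Q ≤ δ * C := by
    rw [hC, mul_div_cancel₀ _ hδ.ne']
    have : y * util σ Q = sSup S * util σ Q + δ * util σ Q := add_mul _ _ _
    linarith
  have := le_of_mul_le_mul_left h4 hδ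
  linarith

lemma exists_small (hT : HasJumps σ α B T) (hσ : σ ∈ Ioo (0:ℝ) 1) (hα : α ∈ Icc (0:ℝ) 1)
    (h : IsOptimalShare σ α z₀ B) (hle : ∀ m > 0, T m ≤ z₀ * util σ m)
    {z : ℝ} (hz : z < z₀) {ε : ℝ} (hε : 0 < ε) : ∃ m ∈ Ioc 0 ε, z * util σ m ≤ T m := by
  set A := {a : ℝ | ∀ ε > 0, ∃ m ∈ Ioc 0 ε, a * util σ m ≤ T m}
  have h0A : (0:ℝ) ∈ A := fun ε hε => ⟨ε, ⟨hε, le_rfl⟩, by simpa using hT.nonneg ε hε.le⟩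
  have hub : ∀ a ∈ A, a ≤ z₀ := fun a ha => by
    obtain ⟨m, hm, hmT⟩ := ha 1 one_pos
    exact le_of_mul_le_mul_right (hmT.trans (hle m hm.1)) (util_pos hσ hm.1)
  have hbdd : BddAbove A := ⟨z₀, hub⟩
  suffices hLz : sSup A = z₀ by
    obtain ⟨a, ha, hza⟩ := exists_lt_of_lt_csSup ⟨0, h0A⟩ (hLz ▸ hz)
    obtain ⟨m, hm, hmT⟩ := ha ε hε
    exact ⟨m, hm, (mul_le_mul_of_nonneg_right hza.le (util_nonneg hσ hm.1.le)).trans hmT⟩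
  by_contra hLz
  have hL : sSup A ∈ Ico (0:ℝ) 1 :=
    ⟨le_csSup hbdd h0A, (csSup_le ⟨0, h0A⟩ hub).trans_lt h.mem_share.2⟩
  obtain ⟨δ, hδ, hδ1, hgap⟩ := h.exists_gap hσ hα hL hLz
  obtain ⟨a, ha, haL⟩ := exists_lt_of_lt_csSup ⟨0, h0A⟩ (sub_lt_self (sSup A) hδ)
  suffices hmem : sSup A + δ / 2 ∈ A by linarith [le_csSup hbdd hmem]
  intro p hp
  set y := sSup A + δ with hy_def
  have hy : 0 < y := add_pos_of_nonneg_of_pos hL.1 hδ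
  -- jumps of slope `y` multiply the quantity by at most `ρ`
  set ρ := 1 + kinkSurplus σ (y / 2) / (y / 2 * σ) with hρ_def
  have hyσ : 0 < y / 2 * σ := mul_pos (half_pos hy) hσ.1
  have hρ : 0 < ρ := by
    have := kinkSurplus_pos hσ (half_pos hy)
    positivity
  set r := (δ / 2 / y) ^ (1 / σ)
  have hr : r ^ σ = δ / 2 / y := by
    rw [← rpow_mul (by positivity), one_div_mul_cancel hσ.1.ne', rpow_one]
  have hr0 : 0 < r := by positivity
  obtain ⟨m, hm, hmT⟩ := ha (min p (r * (p / ρ))) (by positivity)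
  have hmT' : (sSup A - δ) * util σ m ≤ T m :=
    (mul_le_mul_of_nonneg_right haL.le (util_nonneg hσ hm.1.le)).trans hmT
  obtain ⟨s, hs, Q, hQ, hG, hTQ⟩ := hT.exists_jump_over hσ ⟨hy, hδ1⟩ (by linarith) hgap hm.1
    hmT' (hm.2.trans (min_le_left _ _))
  have hs0 : 0 < s := hm.1.trans_le hs.1
  have hQ0 : 0 < Q := (hs0.trans_le hs.2).trans hQ
  have hps : p / ρ ≤ s := by
    have h1 : y * s ^ (σ - 1) * (Q - s) ≤ util σ Q := by
      have := hle Q hQ0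
      have := hT.nonneg s hs0.le
      nlinarith [h.mem_share.2, util_pos hσ hQ0]
    have h2 : y / 2 * s ^ (σ - 1) * (Q - s) ≤ kinkSurplus σ (y / 2) * util σ s := by
      have := util_sub_le hσ hs0 hQ0.le (half_pos hy)
      linarith
    have h3 : y / 2 * s ^ (σ - 1) * (Q - s) * s = y / 2 * (Q - s) * (σ * util σ s) := by
      rw [mul_util hσ, ← rpow_sub_one_mul_self (σ := σ) hs0]
      ring
    have h4 : (y / 2 * σ * (Q - s)) * util σ s ≤ (kinkSurplus σ (y / 2) * s) * util σ s := by
      have := mul_le_mul_of_nonneg_right h2 hs0.le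
      linarith
    have h5 := le_of_mul_le_mul_right h4 (util_pos hσ hs0)
    rw [div_le_iff₀ hρ, hρ_def, mul_add, mul_one, ← sub_le_iff_le_add', ← mul_div_assoc,
      le_div_iff₀ hyσ]
    nlinarith
  refine ⟨s, ⟨hs0, hs.2⟩, ?_⟩
  have h1 : util σ m ≤ δ / 2 / y * util σ s := by
    rw [← hr, ← util_mul hr0.le hs0.le]
    exact util_le hσ hm.1.le
      ((hm.2.trans (min_le_right _ _)).trans (mul_le_mul_of_nonneg_left hps hr0.le))
  have h2 : y * util σ m ≤ δ / 2 * util σ s := by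
    have := mul_le_mul_of_nonneg_left h1 hy.le
    rwa [← mul_assoc, mul_div_cancel₀ _ hy.ne'] at this
  have := hT.nonneg m hm.1.le
  have : y * util σ s = sSup A * util σ s + δ * util σ s := add_mul _ _ _
  linarith

lemma eq_optimal (hT : HasJumps σ α B T) (hσ : σ ∈ Ioo (0:ℝ) 1) (hα : α ∈ Icc (0:ℝ) 1)
    (h : IsOptimalShare σ α z₀ B) (hle : ∀ m > 0, T m ≤ z₀ * util σ m)
    {p : ℝ} (hp : 0 < p) : T p = z₀ * util σ p := by
  refine (hle p hp).antisymm ?_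
  by_contra! hlt
  obtain ⟨hz0, hz1⟩ := h.mem_share
  have hup := util_pos hσ hp
  obtain ⟨θ, hθ, hθz⟩ : ∃ θ, max (T p / util σ p) 0 < θ ∧ θ < z₀ :=
    exists_between (max_lt ((div_lt_iff₀ hup).2 hlt) hz0)
  obtain ⟨hθT, hθ0⟩ := max_lt_iff.1 hθ
  rw [div_lt_iff₀ hup] at hθT
  obtain ⟨y₁, hθy, hyz⟩ := exists_between hθz
  have hratio : 1 < y₁ / θ := (one_lt_div hθ0).2 hθy
  set x₀ := (y₁ / θ) ^ (1 / σ) with hx₀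
  have hx₀1 : 1 < x₀ := one_lt_rpow hratio (one_div_pos.2 hσ.1)
  have hx₀σ : x₀ ^ σ = y₁ / θ := by
    rw [hx₀, ← rpow_mul (by positivity), one_div_mul_cancel hσ.1.ne', rpow_one]
  have hx₀pos : 0 < x₀ ^ σ := by positivity
  set f := (1 - σ + σ * x₀) / x₀ ^ σ with hf
  have hf1 : 1 < f := (one_lt_div hx₀pos).2 (rpow_lt_affine hσ (by linarith) hx₀1.ne')
  obtain ⟨y, hy, hyz₀⟩ : ∃ y, max y₁ (z₀ / f) < y ∧ y < z₀ :=
    exists_between (max_lt hyz (div_lt_self hz0 hf1))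
  obtain ⟨hy₁, hyf⟩ := max_lt_iff.1 hy
  have hy0 : 0 < y := (hθ0.trans hθy).trans hy₁
  obtain ⟨m, hm, hmT⟩ := hT.exists_small hσ hα h hle hyz₀ hp
  obtain ⟨s, hs, Q, hQ, hG, hTQ⟩ := hT.exists_jump_over hσ ⟨hy0, by linarith⟩ le_rfl
    (h.lt_mul y ⟨hy0, by linarith⟩ hyz₀.ne) hm.1 hmT hm.2
  have hs0 : 0 < s := hm.1.trans_le hs.1
  have hus := util_pos hσ hs0
  have hQ0 : 0 < Q := hp.trans hQ
  have hTs : y * util σ s ≤ T s := by linarith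
  set x := Q / s with hx
  have hxs : Q = x * s := (div_mul_cancel₀ _ hs0.ne').symm
  have hx0 : 0 < x := by positivity
  have hx₀x : x₀ ≤ x := by
    rw [hx, le_div_iff₀ hs0]
    refine le_trans ?_ hQ.le
    by_contra! hps
    have h1 := util_lt hσ hp.le hps
    rw [util_mul (by linarith) hs0.le, hx₀σ, div_mul_eq_mul_div, lt_div_iff₀ hθ0] at h1
    have h2 := hT.mono hs0.le hp.le hs.2
    have h3 := mul_lt_mul_of_pos_right hy₁ hus
    linarith
  have hv : 1 ≤ x / x₀ := (one_le_div (by linarith)).2 hx₀x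
  have hfx : f * x ^ σ ≤ 1 - σ + σ * x := by
    have h1 := rpow_le_affine hσ (x := x / x₀) (by linarith)
    rw [div_rpow hx0.le (by linarith)] at h1
    have h2 : f * x ^ σ = (1 - σ + σ * x₀) * (x ^ σ / x₀ ^ σ) := by rw [hf]; ring
    have h3 : x = x₀ * (x / x₀) := (mul_div_cancel₀ _ (by linarith)).symm
    set v := x / x₀
    have h4 : 0 ≤ 1 - σ + σ * x₀ := by nlinarith [hσ.1, hσ.2]
    have h5 : 0 ≤ σ * (1 - σ) * ((x₀ - 1) * (v - 1)) :=
      mul_nonneg (mul_nonneg hσ.1.le (by linarith [hσ.2]))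
        (mul_nonneg (by linarith) (by linarith))
    rw [h2]
    refine (mul_le_mul_of_nonneg_left h1 h4).trans ?_
    rw [h3]
    linarith
  have hchain : y * (1 - σ + σ * x) * util σ s ≤ z₀ * x ^ σ * util σ s := by
    have h1 := hTQ.trans (hle Q hQ0)
    have h2 : y * s ^ (σ - 1) * (Q - s) = y * (x - 1) * (σ * util σ s) := by
      rw [mul_util hσ, ← rpow_sub_one_mul_self (σ := σ) hs0, hxs]
      ring
    rw [h2, hxs, util_mul hx0.le hs0.le] at h1
    linarith
  have h1 := le_of_mul_le_mul_right hchain hus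
  have h2 := mul_le_mul_of_nonneg_left hfx hy0.le
  have h3 : y * f * x ^ σ ≤ z₀ * x ^ σ := by linarith
  have h4 := le_of_mul_le_mul_right h3 (by positivity)
  rw [div_lt_iff₀ (by linarith)] at hyf
  linarith

end HasJumps

/-- The running supremum of a transfer. -/
def runningSup (t : ℝ → ℝ) (m : ℝ) : ℝ := sSup (t '' Icc 0 m)

/-- Against every kinked cost whose slope is at most the marginal utility at the kink, the
seller's supply exists and the regulator's surplus is at least `B` times the efficient one. -/
def IsKinkRobust (σ α B : ℝ) (t : ℝ → ℝ) : Prop :=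
  ∀ m > 0, ∀ y ∈ Ioc (0:ℝ) 1, ∃ Q,
    IsSmallestArgmaxOn (fun q => t q - kink m (y * m ^ (σ - 1)) q) (Ici 0) Q ∧
    B * (kinkSurplus σ y * util σ m) ≤
      util σ Q - t Q + α * (t Q - kink m (y * m ^ (σ - 1)) Q)

lemma sub_kink_mem_upperBounds {t : ℝ → ℝ} {m k Q : ℝ}
    (hQ : IsSmallestArgmaxOn (fun q => t q - kink m k q) (Ici 0) Q) :
    t Q - kink m k Q ∈ upperBounds (t '' Icc 0 m) := by
  rintro _ ⟨q, hq, rfl⟩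
  have := hQ.2.1 q hq.1
  simpa only [kink_of_le hq.2, sub_zero] using this

namespace IsKinkRobust

variable {σ α z₀ B : ℝ} {t : ℝ → ℝ}

lemma bddAbove (ht : IsKinkRobust σ α B t) {m : ℝ} (hm : 0 < m) :
    BddAbove (t '' Icc 0 m) := by
  obtain ⟨Q, hQ, -⟩ := ht m hm 1 (right_mem_Ioc.2 one_pos)
  exact ⟨_, sub_kink_mem_upperBounds hQ⟩

lemma le_runningSup (ht : IsKinkRobust σ α B t) {m q : ℝ} (hm : 0 < m) (hq : q ∈ Icc 0 m) :
    t q ≤ runningSup t m :=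
  le_csSup (ht.bddAbove hm) ⟨q, hq, rfl⟩

lemma runningSup_le {m b : ℝ} (hm : 0 ≤ m) (hb : b ∈ upperBounds (t '' Icc 0 m)) :
    runningSup t m ≤ b :=
  csSup_le ⟨t 0, 0, ⟨le_rfl, hm⟩, rfl⟩ hb

lemma hasJumps (ht : IsKinkRobust σ α B t) (hσ : σ ∈ Ioo (0:ℝ) 1) (hα : α ∈ Icc (0:ℝ) 1)
    (htpos : ∀ q ≥ (0:ℝ), 0 ≤ t q) : HasJumps σ α B (runningSup t) where
  mono a ha b hb hab := by
    have hb1 : BddAbove (t '' Icc 0 b) := (ht.bddAbove (add_pos_of_nonneg_of_pos hb one_pos)).mono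
      (image_mono (Icc_subset_Icc_right (by linarith)))
    exact csSup_le_csSup hb1 ⟨t 0, 0, ⟨le_rfl, ha⟩, rfl⟩ (image_mono (Icc_subset_Icc_right hab))
  nonneg q hq := Real.sSup_nonneg (by rintro _ ⟨x, hx, rfl⟩; exact htpos x hx.1)
  jump m hm y hy l hl hlm := by
    obtain ⟨Q, hQ, hr⟩ := ht m hm y hy
    have hQ0 : 0 ≤ Q := hQ.1
    have hTQ := runningSup_le hm.le (sub_kink_mem_upperBounds hQ)
    have hmQ : m < Q := by
      by_contra! hQm
      rw [kink_of_le hQm, sub_zero] at hTQ hr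
      have h1 := util_le hσ hQ0 hQm
      have h2 := mul_le_mul_of_nonneg_left (hlm.trans hTQ) (sub_nonneg.2 hα.2)
      have h3 := mul_lt_mul_of_pos_right hl (util_pos hσ hm)
      linarith
    refine ⟨Q, hmQ, ?_⟩
    rw [kink_of_ge hmQ.le] at hTQ
    have := ht.le_runningSup (hm.trans hmQ) ⟨hQ0, le_rfl⟩
    linarith

lemma runningSup_le_mul_util (ht : IsKinkRobust σ α B t) (hσ : σ ∈ Ioo (0:ℝ) 1)
    (hα : α < 1) {m : ℝ} (hm : 0 < m) :
    runningSup t m ≤ (1 - B) / (1 - α) * util σ m := by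
  obtain ⟨Q, hQ, hr⟩ := ht m hm 1 (right_mem_Ioc.2 one_pos)
  have hTQ := runningSup_le hm.le (sub_kink_mem_upperBounds hQ)
  have h1 : util σ Q - kink m (1 * m ^ (σ - 1)) Q ≤ kinkSurplus σ 1 * util σ m :=
    (isLUB_kink_surplus hσ hm one_pos le_rfl).1 ⟨Q, hQ.1, rfl⟩
  rw [kinkSurplus_one] at h1 hr
  rw [div_mul_eq_mul_div, le_div_iff₀ (by linarith)]
  have h2 := mul_le_mul_of_nonneg_right hTQ (sub_pos.2 hα).le
  linarith

lemma eq_mul_util (ht : IsKinkRobust σ α B t) (hσ : σ ∈ Ioo (0:ℝ) 1) (hα : α ∈ Icc (0:ℝ) 1)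
    (h : IsOptimalShare σ α z₀ B) (ht0 : t 0 = 0) (htpos : ∀ q ≥ (0:ℝ), 0 ≤ t q)
    {q : ℝ} (hq : 0 ≤ q) : t q = z₀ * util σ q := by
  rcases hq.eq_or_lt with rfl | hq
  · rw [ht0, util_zero hσ, mul_zero]
  have hα1 := h.weight_lt_one hσ hα
  have hJ := ht.hasJumps hσ hα htpos
  have hle : ∀ m > 0, runningSup t m ≤ z₀ * util σ m := fun m hm =>
    hJ.le_optimal hσ hα h
      ((div_lt_one (by linarith)).2 (by linarith [h.weight_lt hσ hα]))
      (fun m hm => ht.runningSup_le_mul_util hσ hα1 hm) hm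
  have hT := hJ.eq_optimal hσ hα h hle hq
  have htle : ∀ x > 0, t x ≤ z₀ * util σ x := fun x hx =>
    (ht.le_runningSup hx ⟨hx.le, le_rfl⟩).trans (hle x hx)
  refine (htle q hq).antisymm ?_
  obtain ⟨hz0, hz1⟩ := h.mem_share
  obtain ⟨Q, hQ, -⟩ := ht q hq 1 (right_mem_Ioc.2 one_pos)
  have hTQ := runningSup_le hq.le (sub_kink_mem_upperBounds hQ)
  rw [hT] at hTQ
  rcases lt_trichotomy Q q with hlt | rfl | hgt
  · rw [kink_of_le hlt.le, sub_zero] at hTQ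
    have h1 := mul_lt_mul_of_pos_left (util_lt hσ hQ.1 hlt) hz0
    rcases (show 0 ≤ Q from hQ.1).eq_or_lt with rfl | hQ0
    · rw [ht0] at hTQ
      linarith [mul_pos hz0 (util_pos hσ hq)]
    · linarith [htle Q hQ0]
  · rwa [kink_of_le le_rfl, sub_zero] at hTQ
  · have h1 := htle Q (hq.trans hgt)
    rw [kink_of_ge hgt.le, one_mul] at hTQ
    have h2 := mul_le_mul_of_nonneg_left (util_le_tangent hσ hq (hq.trans hgt).le) hz0.le
    have h3 : 0 < q ^ (σ - 1) * (Q - q) := mul_pos (by positivity) (sub_pos.2 hgt)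
    nlinarith

end IsKinkRobust

section ProportionalTransfer

variable {σ α z₀ B : ℝ}

/-- If `q₀` maximizes `z u - c` for a convex cost `c`, then `z u'(q₀)` is a subgradient of `c`. -/
lemma subgradient_of_argmax {c : ℝ → ℝ} (hc : ConvexOn ℝ (Ici 0) c) {z q₀ : ℝ}
    (hσ : σ ∈ Ioo (0:ℝ) 1) (hq₀ : 0 < q₀)
    (hmax : ∀ x ∈ Ici (0:ℝ), z * util σ x - c x ≤ z * util σ q₀ - c q₀) {q : ℝ} (hq : 0 ≤ q) :
    c q₀ + z * q₀ ^ (σ - 1) * (q - q₀) ≤ c q := by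
  have hline : HasDerivAt (fun r : ℝ => q₀ + r * (q - q₀)) (q - q₀) 0 := by
    simpa using ((hasDerivAt_id (0:ℝ)).mul_const (q - q₀)).const_add q₀
  have hd : HasDerivAt (fun r : ℝ => z * util σ (q₀ + r * (q - q₀)))
      (z * q₀ ^ (σ - 1) * (q - q₀)) 0 := by
    have h1 : HasDerivAt (util σ) (q₀ ^ (σ - 1)) (q₀ + 0 * (q - q₀)) := by
      rw [zero_mul, add_zero]
      have := (hasDerivAt_rpow_const (x := q₀) (p := σ) (Or.inl hq₀.ne')).div_const σ
      rwa [mul_div_cancel_left₀ _ hσ.1.ne'] at this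
    have := (h1.comp (0:ℝ) hline).const_mul z
    rwa [← mul_assoc] at this
  rw [hasDerivAt_iff_tendsto_slope] at hd
  suffices h : z * q₀ ^ (σ - 1) * (q - q₀) ≤ c q - c q₀ by linarith
  refine le_of_tendsto (hd.mono_left (nhdsGT_le_nhdsNE (0:ℝ))) ?_
  filter_upwards [Ioo_mem_nhdsGT (zero_lt_one' ℝ)] with r hr
  rw [slope_def_field, sub_zero, zero_mul, add_zero, div_le_iff₀ hr.1]
  have hcvx := hc.2 hq₀.le hq (sub_nonneg.2 hr.2.le) hr.1.le (by ring)
  have hpt : (1 - r) • q₀ + r • q = q₀ + r * (q - q₀) := by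
    simp only [smul_eq_mul]; ring
  rw [hpt] at hcvx
  simp only [smul_eq_mul] at hcvx
  have hmem : q₀ + r * (q - q₀) ∈ Ici (0:ℝ) := by
    rw [mem_Ici]
    nlinarith [mul_nonneg hr.1.le hq, mul_nonneg (sub_nonneg.2 hr.2.le) hq₀.le]
  have := hmax _ hmem
  linarith

lemma argmax_pos {c : ℝ → ℝ} (hc : CostCcx c) {z q₀ : ℝ} (hσ : σ ∈ Ioo (0:ℝ) 1) (hz : 0 < z)
    (hq₀ : 0 ≤ q₀)
    (hmax : ∀ x ∈ Ici (0:ℝ), z * util σ x - c x ≤ z * util σ q₀ - c q₀) : 0 < q₀ := by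
  refine lt_of_le_of_ne hq₀ ?_
  rintro rfl
  obtain ⟨-, -, hcvx, hc0, -⟩ := hc
  rw [util_zero hσ, hc0] at hmax
  have h1σ : 0 < 1 - σ := by linarith [hσ.2]
  have hle : ∀ q ∈ Ioc (0:ℝ) 1, z / σ ≤ q ^ (1 - σ) * c 1 := fun q hq => by
    have h1 := hmax q hq.1.le
    have h2 := hcvx.2 self_mem_Ici (mem_Ici.2 zero_le_one) (sub_nonneg.2 hq.2) hq.1.le
      (by ring)
    simp only [smul_eq_mul, mul_zero, mul_one, hc0, zero_add] at h2
    have h3 : z / σ * q ^ σ ≤ q ^ (1 - σ) * c 1 * q ^ σ := by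
      have : q ^ (1 - σ) * c 1 * q ^ σ = q * c 1 := by
        rw [mul_right_comm, ← rpow_add hq.1, sub_add_cancel, rpow_one]
      rw [this, div_mul_eq_mul_div, ← mul_div_assoc']
      unfold util at h1
      linarith
    exact le_of_mul_le_mul_right h3 (rpow_pos_of_pos hq.1 _)
  have hlim : Tendsto (fun q : ℝ => q ^ (1 - σ) * c 1) (𝓝[>] 0) (𝓝 0) := by
    have : Continuous fun q : ℝ => q ^ (1 - σ) * c 1 :=
      (continuous_rpow_const h1σ.le).mul continuous_const
    have h := (this.tendsto 0).mono_left (nhdsWithin_le_nhds (s := Ioi 0))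
    rwa [zero_rpow h1σ.ne', zero_mul] at h
  have hge : z / σ ≤ 0 := ge_of_tendsto hlim (by
    filter_upwards [Ioc_mem_nhdsGT (zero_lt_one' ℝ)] with q hq using hle q hq)
  exact hge.not_gt (div_pos hz hσ.1)

lemma le_surplus_ratio (h : IsOptimalShare σ α z₀ B) (hσ : σ ∈ Ioo (0:ℝ) 1)
    (hα : α ∈ Icc (0:ℝ) 1) {c : ℝ → ℝ} (hc : CostCcx c) {q₀ : ℝ} (hq₀ : 0 ≤ q₀)
    (hmax : ∀ x ∈ Ici (0:ℝ), z₀ * util σ x - c x ≤ z₀ * util σ q₀ - c q₀) :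
    B ≤ (util σ q₀ - z₀ * util σ q₀ + α * (z₀ * util σ q₀ - c q₀)) /
      sSup {x | ∃ q ≥ (0:ℝ), x = util σ q - c q} := by
  obtain ⟨hz0, hz1⟩ := h.mem_share
  have hpos := argmax_pos hc hσ hz0 hq₀ hmax
  have hu := util_pos hσ hpos
  have hsub := fun q hq => subgradient_of_argmax hc.2.2.1 hσ hpos hmax (q := q) hq
  have hc0 := hc.1 q₀ hq₀
  have hcle : c q₀ ≤ z₀ * (σ * util σ q₀) := by
    have := hsub 0 le_rfl
    rw [hc.2.2.2.1, zero_sub, mul_neg, mul_assoc, rpow_sub_one_mul_self hpos,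
      ← mul_util hσ] at this
    linarith
  set S := {x | ∃ q ≥ (0:ℝ), x = util σ q - c q}
  have hmem : util σ q₀ - c q₀ ∈ S := ⟨q₀, hq₀, rfl⟩
  have hub : kinkSurplus σ z₀ * util σ q₀ - c q₀ ∈ upperBounds S := by
    rintro _ ⟨q, hq, rfl⟩
    have := util_sub_le hσ hpos hq hz0
    have := hsub q hq
    linarith
  have hWle := csSup_le ⟨_, hmem⟩ hub
  have hleW := le_csSup ⟨_, hub⟩ hmem
  have hWpos : 0 < sSup S := by
    refine lt_of_lt_of_le ?_ hleW
    have : z₀ * σ < 1 := by nlinarith [hσ.1, hσ.2]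
    nlinarith
  rw [le_div_iff₀ hWpos]
  refine (mul_le_mul_of_nonneg_left hWle (h.pos hσ hα).le).trans ?_
  have h1 : B * (kinkSurplus σ z₀ * util σ q₀) = (1 - (1 - α) * z₀) * util σ q₀ := by
    rw [h.eq_mul, mul_assoc]
  have h2 := mul_le_mul_of_nonneg_right (h.weight_lt hσ hα).le hc0
  linarith

lemma argmax_kink {z q₀ : ℝ} (hσ : σ ∈ Ioo (0:ℝ) 1) (hz : 0 < z) {m : ℝ} (hm : 0 < m)
    (hq₀ : IsSmallestArgmaxOn (fun q => z * util σ q - kink m (z * m ^ (σ - 1)) q) (Ici 0) q₀) :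
    q₀ = m := by
  have hk : 0 ≤ z * m ^ (σ - 1) := by positivity
  have hmm := kink_of_le (k := z * m ^ (σ - 1)) (le_refl m)
  refine le_antisymm (hq₀.2.2 m hm.le fun x hx => ?_) ?_
  · simp only [hmm]
    have h1 := mul_le_mul_of_nonneg_left (util_le_tangent hσ hm hx) hz.le
    have h2 := le_kink (m := m) (q := x) hk
    linarith
  · by_contra! hlt
    have h1 := hq₀.2.1 m hm.le
    simp only [hmm, kink_of_le hlt.le] at h1
    have := mul_lt_mul_of_pos_left (util_lt hσ hq₀.1 hlt) hz
    linarith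

end ProportionalTransfer

lemma isOptimalShare_of_unique_max {σ α zstar : ℝ} (hσ : σ ∈ Ioo (0:ℝ) 1)
    (hzs : zstar ∈ Ioo (0:ℝ) 1)
    (hmax : ∀ z ∈ Ioo (0:ℝ) 1, (1 - (1 - α) * z) / kinkSurplus σ z ≤
      (1 - (1 - α) * zstar) / kinkSurplus σ zstar)
    (huniq : ∀ z ∈ Ioo (0:ℝ) 1, (∀ w ∈ Ioo (0:ℝ) 1, (1 - (1 - α) * w) / kinkSurplus σ w ≤
      (1 - (1 - α) * z) / kinkSurplus σ z) → z = zstar) :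
    IsOptimalShare σ α zstar ((1 - (1 - α) * zstar) / kinkSurplus σ zstar) where
  mem_share := hzs
  eq_mul := (div_mul_cancel₀ _ (kinkSurplus_pos hσ hzs.1).ne').symm
  lt_mul z hz hne := by
    rw [← div_lt_iff₀ (kinkSurplus_pos hσ hz.1)]
    refine lt_of_le_of_ne (hmax z hz) fun heq => hne (huniq z hz fun w hw => ?_)
    rw [heq]
    exact hmax w hw

/-- Theorem 3: competitive ratio of regulation.
For `σ ∈ (0,1)`, `u(q) = q^σ/σ`, and profit weight `α ∈ [0,1]`, for every mechanism `t`
the infimum over `c ∈ C_cx` of the weighted regulator surplus ratio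
`(U(c,t) + α·Π(c,t))/W(c)` is at most `B_α(σ) = ψ_{α,σ}(z_α*)`, with equality iff
`t(q) = z_α*·u(q)` for all `q ≥ 0`.  Here `z_α*` is the unique maximizer on `(0,1)` of
`ψ_{α,σ}(z) = (1 − (1−α)z)/((1−σ) z^{−σ/(1−σ)} + σ z)`. -/
theorem stmt_11 (σ α : ℝ) (hσ : σ ∈ Ioo (0:ℝ) 1) (hα : α ∈ Icc (0:ℝ) 1)
    (u : ℝ → ℝ) (hu : ∀ q, u q = q ^ σ / σ)
    (ψ : ℝ → ℝ)
    (hψ : ∀ z, ψ z = (1 - (1 - α) * z) / ((1 - σ) * z ^ (-(σ / (1 - σ))) + σ * z))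
    (zstar B : ℝ) (hzs : zstar ∈ Ioo (0:ℝ) 1)
    (hmax : ∀ z ∈ Ioo (0:ℝ) 1, ψ z ≤ ψ zstar)
    (huniq : ∀ z ∈ Ioo (0:ℝ) 1, (∀ w ∈ Ioo (0:ℝ) 1, ψ w ≤ ψ z) → z = zstar)
    (hB : B = ψ zstar)
    (W : (ℝ → ℝ) → ℝ) (hW : ∀ c, W c = sSup {x | ∃ q ≥ (0:ℝ), x = u q - c q})
    (t : ℝ → ℝ) (ht0 : t 0 = 0) (htpos : ∀ q ≥ (0:ℝ), 0 ≤ t q)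
    (Q : (ℝ → ℝ) → ℝ)
    (hQ : ∀ c, CostCcx c → IsSmallestArgmaxOn (fun q => t q - c q) (Ici 0) (Q c)) :
    sInf {r | ∃ c, CostCcx c ∧
        r = ((u (Q c) - t (Q c)) + α * (t (Q c) - c (Q c))) / W c} ≤ B ∧
    (sInf {r | ∃ c, CostCcx c ∧
        r = ((u (Q c) - t (Q c)) + α * (t (Q c) - c (Q c))) / W c} = B ↔
      ∀ q ≥ (0:ℝ), t q = zstar * u q) := by
  obtain rfl : u = util σ := funext hu
  obtain rfl : B = (1 - (1 - α) * zstar) / kinkSurplus σ zstar := hB.trans (hψ zstar)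
  have hψ' : ∀ z, ψ z = (1 - (1 - α) * z) / kinkSurplus σ z := hψ
  simp only [hψ'] at hmax huniq
  have h := isOptimalShare_of_unique_max hσ hzs hmax huniq
  set B := (1 - (1 - α) * zstar) / kinkSurplus σ zstar
  have hBpos := h.pos hσ hα
  set R := {r | ∃ c, CostCcx c ∧
    r = ((util σ (Q c) - t (Q c)) + α * (t (Q c) - c (Q c))) / W c}
  have hk : ∀ m > 0, ∀ y > 0, CostCcx (kink m (y * m ^ (σ - 1))) := fun m hm y hy =>
    costCcx_kink hm.le (by positivity)
  have hWk : ∀ m > 0, ∀ y ∈ Ioc (0:ℝ) 1,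
      W (kink m (y * m ^ (σ - 1))) = kinkSurplus σ y * util σ m := fun m hm y hy => by
    rw [hW]
    exact (isLUB_kink_surplus hσ hm hy.1 hy.2).csSup_eq ⟨_, 0, le_rfl, rfl⟩
  have hRne : R.Nonempty := ⟨_, _, hk 1 one_pos 1 one_pos, rfl⟩
  have hforce : (∀ r ∈ R, B ≤ r) → ∀ q ≥ (0:ℝ), t q = zstar * util σ q := by
    intro hlb q hq
    refine IsKinkRobust.eq_mul_util (fun m hm y hy => ?_) hσ hα h ht0 htpos hq
    refine ⟨Q (kink m (y * m ^ (σ - 1))), hQ _ (hk m hm y hy.1), ?_⟩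
    have hr := hlb _ ⟨_, hk m hm y hy.1, rfl⟩
    rwa [hWk m hm y hy, le_div_iff₀ (mul_pos (kinkSurplus_pos hσ hy.1) (util_pos hσ hm))] at hr
  have hargmax : (∀ q ≥ (0:ℝ), t q = zstar * util σ q) → ∀ c, CostCcx c →
      IsSmallestArgmaxOn (fun q => zstar * util σ q - c q) (Ici 0) (Q c) := by
    intro ht c hc
    obtain ⟨h1, h2, h3⟩ := hQ c hc
    refine ⟨h1, fun x hx => ?_, fun x hx hx' => h3 x hx fun y hy => ?_⟩
    · simpa only [ht x hx, ht _ h1] using h2 x hx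
    · simpa only [ht x hx, ht y hy] using hx' y hy
  have hmem : (∀ q ≥ (0:ℝ), t q = zstar * util σ q) → B ∈ R := by
    intro ht
    have hc := hk 1 one_pos zstar hzs.1
    have hq := argmax_kink hσ hzs.1 one_pos (hargmax ht _ hc)
    refine ⟨_, hc, ?_⟩
    rw [hq, hWk 1 one_pos zstar (Ioo_subset_Ioc_self hzs), ht 1 zero_le_one, kink_of_le le_rfl,
      eq_div_iff (mul_pos (kinkSurplus_pos hσ hzs.1) (util_pos hσ one_pos)).ne', ← mul_assoc,
      ← h.eq_mul]
    ring
  have hlow : (∀ q ≥ (0:ℝ), t q = zstar * util σ q) → ∀ r ∈ R, B ≤ r := by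
    rintro ht _ ⟨c, hc, rfl⟩
    obtain ⟨h1, h2, -⟩ := hargmax ht c hc
    rw [ht _ h1, hW]
    exact le_surplus_ratio h hσ hα hc h1 h2
  have hlb : B ≤ sInf R → ∀ r ∈ R, B ≤ r := fun hle r hr => by
    have hbdd : BddBelow R := by
      by_contra hb
      rw [Real.sInf_of_not_bddBelow hb] at hle
      linarith
    exact hle.trans (csInf_le hbdd hr)
  have hsuff : (∀ q ≥ (0:ℝ), t q = zstar * util σ q) → sInf R = B := fun ht =>
    IsLeast.csInf_eq ⟨hmem ht, hlow ht⟩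
  refine ⟨?_, fun heq => hforce (hlb heq.ge), hsuff⟩
  by_contra! hlt
  exact hlt.ne' (hsuff (hforce (hlb hlt.le)))
end
end

section
/- For every σ ∈ (0,1), the competitive ratio B_α(σ) of the regulation problem is nondecreasing in the profit weight α ∈ [0,1], and B_α(σ) → 1 as α → 1. -/
open Real Set

noncomputable section

/-- Weighted AM-GM: the two summands have weighted geometric mean `1`. -/
lemma one_le_weighted_rpow_add {σ z : ℝ} (hσ : σ ∈ Ioo (0:ℝ) 1) (hz : 0 < z) :
    1 ≤ (1 - σ) * z ^ (-(σ / (1 - σ))) + σ * z := by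
  have h1 : 0 < 1 - σ := sub_pos.2 hσ.2
  have h := Real.geom_mean_le_arith_mean2_weighted h1.le hσ.1.le
    (rpow_nonneg hz.le (-(σ / (1 - σ)))) hz.le (by ring)
  have hexp : -(σ / (1 - σ)) * (1 - σ) + σ = 0 := by
    field_simp
    ring
  rwa [← rpow_mul hz.le, ← rpow_add hz, hexp, rpow_zero] at h

/-- Corollary 1: comparative statics of the regulation competitive
ratio.  For every `σ ∈ (0,1)`, the competitive ratio
`B_α(σ) = sup_{z ∈ (0,1)} (1 − (1−α)z)/((1−σ) z^{−σ/(1−σ)} + σ z)` is nondecreasing in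
the profit weight `α ∈ [0,1]`, and `B_α(σ) → 1` as `α → 1`. -/
theorem stmt_12 (σ : ℝ) (hσ : σ ∈ Ioo (0:ℝ) 1)
    (ψ : ℝ → ℝ → ℝ)
    (hψ : ∀ α z, ψ α z = (1 - (1 - α) * z) / ((1 - σ) * z ^ (-(σ / (1 - σ))) + σ * z))
    (B : ℝ → ℝ) (hB : ∀ α, B α = sSup ((ψ α) '' Ioo 0 1)) :
    MonotoneOn B (Icc 0 1) ∧
    Filter.Tendsto B (nhdsWithin 1 (Ico 0 1)) (nhds 1) := by
  have hD {z : ℝ} (hz : z ∈ Ioo (0:ℝ) 1) := one_le_weighted_rpow_add hσ hz.1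
  have hle {α z : ℝ} (hα : α ≤ 1) (hz : z ∈ Ioo (0:ℝ) 1) : ψ α z ≤ 1 := by
    rw [hψ, div_le_one (by linarith [hD hz])]
    nlinarith [hD hz, mul_nonneg (sub_nonneg.2 hα) hz.1.le]
  have hbdd {α : ℝ} (hα : α ≤ 1) : BddAbove (ψ α '' Ioo 0 1) :=
    ⟨1, forall_mem_image.2 fun _ hz => hle hα hz⟩
  have hne (α : ℝ) : (ψ α '' Ioo 0 1).Nonempty := (nonempty_Ioo.2 one_pos).image _
  have hB_le {α : ℝ} (hα : α ≤ 1) : B α ≤ 1 := by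
    rw [hB]
    exact csSup_le (hne α) (forall_mem_image.2 fun _ hz => hle hα hz)
  have hψ_le {α z : ℝ} (hα : α ≤ 1) (hz : z ∈ Ioo (0:ℝ) 1) : ψ α z ≤ B α := by
    rw [hB]
    exact le_csSup (hbdd hα) (mem_image_of_mem _ hz)
  have hle_B {α : ℝ} (hα : α ≤ 1) : α ≤ B α := by
    have hcont : ContinuousAt (ψ α) 1 := by
      rw [funext (hψ α)]
      refine ContinuousAt.div (by fun_prop) ?_ (by simp)
      exact (continuousAt_const.mul (continuousAt_rpow_const _ _ (Or.inl one_ne_zero))).add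
        (by fun_prop)
    have hval : ψ α 1 = α := by simp [hψ]
    have hlim : Filter.Tendsto (ψ α) (nhdsWithin 1 (Iio 1)) (nhds α) := by
      simpa only [hval] using hcont.tendsto.mono_left nhdsWithin_le_nhds
    refine le_of_tendsto hlim ?_
    filter_upwards [Ioo_mem_nhdsLT one_pos] with z hz using hψ_le hα hz
  constructor
  · intro α _ β hβ hαβ
    rw [hB α]
    refine csSup_le (hne α) (forall_mem_image.2 fun z hz => le_trans ?_ (hψ_le hβ.2 hz))
    have hpos := one_pos.trans_le (hD hz)
    rw [hψ, hψ]
    have := hz.1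
    gcongr
  · refine tendsto_of_tendsto_of_tendsto_of_le_of_le'
      (Filter.tendsto_id.mono_left nhdsWithin_le_nhds) tendsto_const_nhds ?_ ?_
    · filter_upwards [self_mem_nhdsWithin] with α hα using hle_B hα.2.le
    · filter_upwards [self_mem_nhdsWithin] with α hα using hB_le hα.2.le
end
end

section
/- Let σ > 1 and let the seller's cost be c(q) = ((σ−1)/σ)·(q^σ/σ). The buyer with value v > 0 has utility v·q and, facing a payment schedule t, purchases the smallest maximizer q(v,t) of v·q − t(q) over q ≥ 0; the seller's profit is Π(v,t) = t(q(v,t)) − c(q(v,t)) and the efficient social surplus is W(v) = sup_{q ≥ 0}(v·q − c(q)). Then for every payment schedule t : [0,∞) → [0,∞) with t(0) = 0, inf_{v > 0} Π(v,t)/W(v) ≤ σ^{σ/(1−σ)}; moreover this bound is attained (the infimum equals σ^{σ/(1−σ)}) if and only if t(q) = σ·c(q) for all q, i.e., the constant markup schedule with markup fraction (σ−1)/σ over cost. -/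
open Real Set

noncomputable section

section

open Filter Topology

/-- Equality case of Bernoulli's inequality for real exponents. -/
lemma eq_one_of_rpow_le_tangent {σ r : ℝ} (hσ : 1 < σ) (hr : 0 ≤ r)
    (h : r ^ σ ≤ 1 + σ * (r - 1)) : r = 1 := by
  by_contra hne
  have := one_add_mul_self_lt_rpow_one_add (s := r - 1) (by linarith) (sub_ne_zero.2 hne) hσ
  rw [add_sub_cancel] at this
  linarith

lemma tangent_le_rpow {σ r : ℝ} (hσ : 1 < σ) (hr : 0 ≤ r) :
    1 + σ * (r - 1) ≤ r ^ σ := by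
  have := one_add_mul_self_le_rpow_one_add (s := r - 1) (by linarith) hσ.le
  rwa [add_sub_cancel] at this

/-- If the perturbed supporting-line inequalities hold as `l ↓ 1`, the limiting level is `1`. -/
lemma tendsto_one_of_perturbed_support {σ κ L : ℝ} (hσ : 1 < σ) (hκ : 0 < κ) {g x : ℝ → ℝ}
    (hx : ∀ l > 1, 0 ≤ x l) (hg : ∀ l > 1, L - (l - 1) ^ 2 ≤ g l)
    (hgx : ∀ l > 1, g l + κ * (x l ^ σ - (1 + σ * (x l - 1))) ≤ x l)
    (hxl : ∀ l > 1, x l * (σ / (σ - 1) * (l ^ (σ - 1) - 1)) ≤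
      L * (l ^ σ - 1) + l ^ σ * (l - 1) ^ 2) :
    L = 1 ∧ Tendsto x (𝓝[>] 1) (𝓝 1) := by
  have hσ1 : 0 < σ - 1 := sub_pos.2 hσ
  have slope_tendsto (a : ℝ) : Tendsto (fun l : ℝ => (l ^ a - 1) / (l - 1)) (𝓝[>] 1) (𝓝 a) := by
    have h := (Real.hasDerivAt_rpow_const (x := 1) (p := a) (Or.inl one_ne_zero)).tendsto_slope
    rw [Real.one_rpow, mul_one] at h
    refine (h.mono_left (nhdsWithin_mono _ fun l hl => ne_of_gt hl)).congr fun l => ?_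
    rw [slope_def_field, Real.one_rpow]
  have hid : Tendsto (fun l : ℝ => l) (𝓝[>] 1) (𝓝 1) := nhdsWithin_le_nhds
  have hsq : Tendsto (fun l : ℝ => (l - 1) ^ 2) (𝓝[>] 1) (𝓝 0) := by
    simpa using (hid.sub_const 1).pow 2
  have hpow : Tendsto (fun l : ℝ => l ^ σ) (𝓝[>] 1) (𝓝 1) := by
    simpa using hid.rpow_const (p := σ) (Or.inl one_ne_zero)
  have hupper : Tendsto (fun l : ℝ => (L * ((l ^ σ - 1) / (l - 1)) + l ^ σ * (l - 1)) /
      (σ / (σ - 1) * ((l ^ (σ - 1) - 1) / (l - 1)))) (𝓝[>] 1) (𝓝 L) := by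
    have h := (((slope_tendsto σ).const_mul L).add (hpow.mul (hid.sub_const 1))).div
      ((slope_tendsto (σ - 1)).const_mul (σ / (σ - 1))) (by positivity)
    have hlim : (L * σ + 1 * (1 - 1)) / (σ / (σ - 1) * (σ - 1)) = L := by
      field_simp
      ring
    rw [hlim] at h
    exact h
  have hlower : Tendsto (fun l : ℝ => L - (l - 1) ^ 2) (𝓝[>] 1) (𝓝 L) := by
    simpa using tendsto_const_nhds.sub hsq
  have hxL : Tendsto x (𝓝[>] 1) (𝓝 L) := by
    refine tendsto_of_tendsto_of_tendsto_of_le_of_le' hlower hupper ?_ ?_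
    · filter_upwards [self_mem_nhdsWithin] with l hl
      have := mul_nonneg hκ.le (sub_nonneg.2 (tangent_le_rpow hσ (hx l hl)))
      linarith [hg l hl, hgx l hl]
    · filter_upwards [self_mem_nhdsWithin] with l hl
      have hl1 : 0 < l - 1 := sub_pos.2 hl
      have hden : 0 < l ^ (σ - 1) - 1 := sub_pos.2 (Real.one_lt_rpow hl hσ1)
      rw [le_div_iff₀ (by positivity), ← mul_le_mul_iff_left₀ hl1]
      refine (Eq.trans_le ?_ (hxl l hl)).trans_eq ?_ <;> field_simp
  have hL0 : 0 ≤ L := ge_of_tendsto hxL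
    (by filter_upwards [self_mem_nhdsWithin] with l hl using hx l hl)
  have hlim : L + κ * (L ^ σ - (1 + σ * (L - 1))) ≤ L := by
    refine le_of_tendsto_of_tendsto (hlower.add (((hxL.rpow_const (p := σ) (Or.inr (by linarith))).sub
      (((hxL.sub_const 1).const_mul σ).const_add 1)).const_mul κ)) hxL ?_
    filter_upwards [self_mem_nhdsWithin] with l hl
    linarith [hg l hl, hgx l hl]
  have hL : L = 1 := eq_one_of_rpow_le_tangent hσ hL0 (by
    by_contra! h
    linarith [mul_pos hκ (sub_pos.2 h)])
  exact ⟨hL, hL ▸ hxL⟩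

/-- Rigidity for the normalized buyer surplus `g` and normalized purchase `x`. -/
lemma eq_one_of_support {σ κ C : ℝ} (hσ : 1 < σ) (hκ : 0 < κ) {g x : ℝ → ℝ}
    (hx : ∀ z > 0, 0 ≤ x z) (hg0 : ∀ z > 0, 0 ≤ g z) (hgC : ∀ z > 0, g z ≤ C)
    (hgx : ∀ z > 0, g z + κ * (x z ^ σ - (1 + σ * (x z - 1))) ≤ x z)
    (hsupp : ∀ z > 0, ∀ l > 1,
      g z + x z * (σ / (σ - 1) * (l ^ (σ - 1) - 1)) ≤ l ^ σ * g (l * z)) :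
    ∀ z > 0, g z = 1 ∧ x z = 1 := by
  have hne : (g '' Ioi 0).Nonempty := ⟨_, mem_image_of_mem g (mem_Ioi.2 one_pos)⟩
  have hbdd : BddAbove (g '' Ioi 0) := ⟨C, by rintro _ ⟨z, hz, rfl⟩; exact hgC z hz⟩
  have hbdd' : BddBelow (g '' Ioi 0) := ⟨0, by rintro _ ⟨z, hz, rfl⟩; exact hg0 z hz⟩
  have hle (z : ℝ) (hz : 0 < z) : g z ≤ sSup (g '' Ioi 0) := le_csSup hbdd ⟨z, hz, rfl⟩
  have hge (z : ℝ) (hz : 0 < z) : sInf (g '' Ioi 0) ≤ g z := csInf_le hbdd' ⟨z, hz, rfl⟩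
  have hsup : sSup (g '' Ioi 0) = 1 := by
    have hz : ∀ l : ℝ, ∃ z, 1 < l → 0 < z ∧ sSup (g '' Ioi 0) - (l - 1) ^ 2 ≤ g z := by
      intro l
      by_cases hl : 1 < l
      · obtain ⟨_, ⟨z, hz, rfl⟩, h⟩ := exists_lt_of_lt_csSup hne
          (sub_lt_self (sSup (g '' Ioi 0)) (pow_pos (sub_pos.2 hl) 2))
        exact ⟨z, fun _ => ⟨hz, h.le⟩⟩
      · exact ⟨0, fun h => absurd h hl⟩
    choose z hz using hz
    refine (tendsto_one_of_perturbed_support (g := fun l => g (z l)) (x := fun l => x (z l)) hσ hκ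
      (fun l hl => hx _ (hz l hl).1) (fun l hl => (hz l hl).2) (fun l hl => hgx _ (hz l hl).1)
      fun l hl => ?_).1
    have hlσ : 1 ≤ l ^ σ := Real.one_le_rpow hl.le (by linarith)
    have h1 := hsupp _ (hz l hl).1 l hl
    have h2 := mul_le_mul_of_nonneg_left
      (hle (l * z l) (mul_pos (by linarith) (hz l hl).1)) (by linarith : 0 ≤ l ^ σ)
    nlinarith [(hz l hl).2, mul_nonneg (sub_nonneg.2 hlσ) (sq_nonneg (l - 1))]
  have hinf : sInf (g '' Ioi 0) = 1 := by
    have hz : ∀ l : ℝ, ∃ z, 1 < l → 0 < z ∧ g (l * z) ≤ sInf (g '' Ioi 0) + (l - 1) ^ 2 := by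
      intro l
      by_cases hl : 1 < l
      · obtain ⟨_, ⟨z, hz, rfl⟩, h⟩ := exists_lt_of_csInf_lt hne
          (lt_add_of_pos_right (sInf (g '' Ioi 0)) (pow_pos (sub_pos.2 hl) 2))
        have hl0 : 0 < l := by linarith
        refine ⟨z / l, fun _ => ⟨div_pos hz hl0, ?_⟩⟩
        rw [mul_div_cancel₀ _ hl0.ne']
        exact h.le
      · exact ⟨0, fun h => absurd h hl⟩
    choose z hz using hz
    refine (tendsto_one_of_perturbed_support (g := fun l => g (z l)) (x := fun l => x (z l)) hσ hκ
      (fun l hl => hx _ (hz l hl).1) (fun l hl => ?_) (fun l hl => hgx _ (hz l hl).1)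
      fun l hl => ?_).1
    · linarith [hge _ (hz l hl).1, sq_nonneg (l - 1)]
    · have hlσ : 1 ≤ l ^ σ := Real.one_le_rpow hl.le (by linarith)
      have h1 := hsupp _ (hz l hl).1 l hl
      have h2 := mul_le_mul_of_nonneg_left (hz l hl).2 (by linarith : 0 ≤ l ^ σ)
      nlinarith [hge _ (hz l hl).1]
  have hg (z : ℝ) (hz : 0 < z) : g z = 1 :=
    le_antisymm (hsup ▸ hle z hz) (hinf ▸ hge z hz)
  refine fun z hz => ⟨hg z hz, ?_⟩
  have h := (tendsto_one_of_perturbed_support (L := 1) (g := fun _ => g z) (x := fun _ => x z)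
    hσ hκ (fun _ _ => hx z hz) (fun l _ => ?_) (fun _ _ => hgx z hz) fun l hl => ?_).2
  · exact tendsto_nhds_unique tendsto_const_nhds h
  · rw [hg z hz]
    linarith [sq_nonneg (l - 1)]
  · have h1 := hsupp z hz l hl
    rw [hg z hz, hg (l * z) (mul_pos (by linarith) hz)] at h1
    have : 0 ≤ l ^ σ * (l - 1) ^ 2 :=
      mul_nonneg (Real.rpow_nonneg (by linarith) _) (sq_nonneg _)
    linarith

/-- Every positive value is the marginal markup price `(σ - 1) z ^ (σ - 1)` of some `z > 0`. -/
lemma exists_pos_eq_mul_rpow {σ v : ℝ} (hσ : 1 < σ) (hv : 0 < v) :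
    ∃ z > 0, v = (σ - 1) * z ^ (σ - 1) := by
  have hσ1 : 0 < σ - 1 := sub_pos.2 hσ
  refine ⟨(v / (σ - 1)) ^ (σ - 1)⁻¹, by positivity, ?_⟩
  rw [Real.rpow_inv_rpow (by positivity) hσ1.ne']
  field_simp

/-- The efficient surplus, and the guaranteed fraction of it, at the value `(σ - 1) z ^ (σ - 1)`. -/
lemma surplus_eq {σ z : ℝ} (hσ : 1 < σ) (hz : 0 < z) {c : ℝ → ℝ}
    (hc : ∀ q, c q = ((σ - 1) / σ) * (q ^ σ / σ)) :
    σ ^ (σ / (1 - σ)) * sSup {x | ∃ q ≥ (0:ℝ), x = (σ - 1) * z ^ (σ - 1) * q - c q} =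
      ((σ - 1) / σ) ^ 2 * z ^ σ := by
  have hσ0 : 0 < σ := by linarith
  have hσ1 : 0 < σ - 1 := sub_pos.2 hσ
  obtain ⟨s, hs0, hs⟩ : ∃ s > 0, s ^ (σ - 1) = σ :=
    ⟨σ ^ (σ - 1)⁻¹, by positivity, Real.rpow_inv_rpow hσ0.le hσ1.ne'⟩
  have hsσ : s ^ σ = σ * s := by
    rw [← hs, ← Real.rpow_add_one hs0.ne', hs, sub_add_cancel]
  have hzσ : z ^ σ = z ^ (σ - 1) * z := by
    rw [← Real.rpow_add_one hz.ne', sub_add_cancel]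
  have hk : σ ^ (σ / (1 - σ)) * s ^ σ = 1 := by
    nth_rewrite 1 [← hs]
    rw [← Real.rpow_mul hs0.le, ← Real.rpow_add hs0]
    have : (σ - 1) * (σ / (1 - σ)) + σ = 0 := by
      have : 1 - σ ≠ 0 := by linarith
      field_simp
      ring
    rw [this, Real.rpow_zero]
  have hsup : IsGreatest {x | ∃ q ≥ (0:ℝ), x = (σ - 1) * z ^ (σ - 1) * q - c q}
      (((σ - 1) / σ) ^ 2 * (s ^ σ * z ^ σ)) := by
    constructor
    · refine ⟨s * z, by positivity, ?_⟩
      rw [hc, Real.mul_rpow hs0.le hz.le, hsσ, hzσ]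
      field_simp
    · rintro _ ⟨q, hq, rfl⟩
      obtain ⟨r, hr, rfl⟩ : ∃ r, 0 ≤ r ∧ q = s * z * r :=
        ⟨q / (s * z), by positivity, by field_simp⟩
      have hb := mul_le_mul_of_nonneg_left (tangent_le_rpow hσ hr)
        (by positivity : 0 ≤ (σ - 1) / σ ^ 2 * (s ^ σ * z ^ σ))
      rw [hc, Real.mul_rpow (by positivity) hr, Real.mul_rpow hs0.le hz.le]
      have e1 : (σ - 1) * z ^ (σ - 1) * (s * z * r) = (σ - 1) / σ * (s ^ σ * z ^ σ) * r := by
        rw [hsσ, hzσ]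
        field_simp
      rw [e1]
      have e2 : ((σ - 1) / σ) ^ 2 * (s ^ σ * z ^ σ) -
          ((σ - 1) / σ * (s ^ σ * z ^ σ) * r - (σ - 1) / σ * (s ^ σ * z ^ σ * r ^ σ / σ)) =
          (σ - 1) / σ ^ 2 * (s ^ σ * z ^ σ) * r ^ σ -
            (σ - 1) / σ ^ 2 * (s ^ σ * z ^ σ) * (1 + σ * (r - 1)) := by
        field_simp
        ring
      linarith
  rw [hsup.csSup_eq]
  linear_combination ((σ - 1) / σ) ^ 2 * z ^ σ * hk

end

/-- Proposition 4: competitive ratio for nonlinear pricing.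
Let `σ > 1`, seller cost `c(q) = ((σ−1)/σ)·(q^σ/σ)`, buyer utility `v·q` with unknown
value `v > 0`.  The buyer facing a payment schedule `t` purchases the smallest maximizer
`Q v` of `v·q − t(q)` over `q ≥ 0`; the seller's profit is `Π(v,t) = t(Q v) − c(Q v)` and
`W(v) = sup_{q ≥ 0}(v·q − c(q))`.  Then for every payment schedule `t` with `t(0) = 0`,
`inf_{v>0} Π(v,t)/W(v) ≤ σ^{σ/(1−σ)}`, with equality iff `t(q) = σ·c(q)` for all
`q ≥ 0`. -/
theorem stmt_13 (σ : ℝ) (hσ : 1 < σ)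
    (c : ℝ → ℝ) (hc : ∀ q, c q = ((σ - 1) / σ) * (q ^ σ / σ))
    (W : ℝ → ℝ) (hW : ∀ v, W v = sSup {x | ∃ q ≥ (0:ℝ), x = v * q - c q})
    (t : ℝ → ℝ) (ht0 : t 0 = 0) (htpos : ∀ q ≥ (0:ℝ), 0 ≤ t q)
    (Q : ℝ → ℝ)
    (hQ : ∀ v > (0:ℝ), IsSmallestArgmaxOn (fun q => v * q - t q) (Ici 0) (Q v))
    (Pr : ℝ → ℝ) (hPr : ∀ v, Pr v = t (Q v) - c (Q v)) :
    sInf {r | ∃ v > (0:ℝ), r = Pr v / W v} ≤ σ ^ (σ / (1 - σ)) ∧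
    (sInf {r | ∃ v > (0:ℝ), r = Pr v / W v} = σ ^ (σ / (1 - σ)) ↔
      ∀ q ≥ (0:ℝ), t q = σ * c q) := by
  have hσ0 : 0 < σ := by linarith
  have hσ1 : 0 < σ - 1 := sub_pos.2 hσ
  have hk0 : 0 < σ ^ (σ / (1 - σ)) := by positivity
  have hzσ (z : ℝ) (hz : 0 < z) : z ^ σ = z ^ (σ - 1) * z := by
    rw [← Real.rpow_add_one hz.ne', sub_add_cancel]
  have hkW (z : ℝ) (hz : 0 < z) : σ ^ (σ / (1 - σ)) * W ((σ - 1) * z ^ (σ - 1)) =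
      ((σ - 1) / σ) ^ 2 * z ^ σ := by
    rw [hW]
    exact surplus_eq hσ hz hc
  have hWpos (z : ℝ) (hz : 0 < z) : 0 < W ((σ - 1) * z ^ (σ - 1)) :=
    pos_of_mul_pos_right (by rw [hkW z hz]; positivity) hk0.le
  have attained (h : ∀ q ≥ (0:ℝ), t q = σ * c q) :
      sInf {r | ∃ v > (0:ℝ), r = Pr v / W v} = σ ^ (σ / (1 - σ)) := by
    have hratio : ∀ v > 0, Pr v / W v = σ ^ (σ / (1 - σ)) := by
      intro v hv
      obtain ⟨z, hz, rfl⟩ := exists_pos_eq_mul_rpow hσ hv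
      obtain ⟨hQ0, hQmax, -⟩ := hQ _ hv
      have hm := hQmax z hz.le
      rw [div_eq_iff (hWpos z hz).ne', hkW z hz, hPr]
      generalize Q ((σ - 1) * z ^ (σ - 1)) = q at *
      obtain ⟨r, hr, rfl⟩ : ∃ r, 0 ≤ r ∧ q = z * r :=
        ⟨q / z, div_nonneg hQ0 hz.le, by field_simp⟩
      simp only [h z hz.le, h _ hQ0, hc, Real.mul_rpow hz.le hr] at hm ⊢
      have hr1 : r = 1 := by
        refine eq_one_of_rpow_le_tangent hσ hr ?_
        have hp : 0 < (σ - 1) / σ * z ^ σ := by positivity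
        rw [← mul_le_mul_iff_right₀ hp]
        have e : ∀ a b : ℝ, (σ - 1) * z ^ (σ - 1) * (z * a) - σ * ((σ - 1) / σ * (z ^ σ * b / σ)) =
            (σ - 1) / σ * z ^ σ * (σ * a) - (σ - 1) / σ * z ^ σ * b := by
          intro a b
          rw [hzσ z hz]
          field_simp
        have e1 := e 1 1
        rw [mul_one, mul_one] at e1
        rw [e r, e1] at hm
        linarith
      rw [hr1, Real.one_rpow]
      field_simp
    have : {r | ∃ v > (0:ℝ), r = Pr v / W v} = {σ ^ (σ / (1 - σ))} := by
      ext r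
      constructor
      · rintro ⟨v, hv, rfl⟩
        exact hratio v hv
      · rintro rfl
        exact ⟨1, one_pos, (hratio 1 one_pos).symm⟩
    rw [this, csInf_singleton]
  have unique (h : σ ^ (σ / (1 - σ)) ≤ sInf {r | ∃ v > (0:ℝ), r = Pr v / W v}) :
      ∀ q ≥ (0:ℝ), t q = σ * c q := by
    have hbdd : BddBelow {r | ∃ v > (0:ℝ), r = Pr v / W v} := by
      by_contra hb
      rw [Real.sInf_of_not_bddBelow hb] at h
      linarith
    have hV (z : ℝ) (hz : 0 < z) : 0 < (σ - 1) * z ^ (σ - 1) := by positivity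
    have hprofit (z : ℝ) (hz : 0 < z) : ((σ - 1) / σ) ^ 2 * z ^ σ ≤
        t (Q ((σ - 1) * z ^ (σ - 1))) - c (Q ((σ - 1) * z ^ (σ - 1))) := by
      rw [← hkW z hz, ← hPr, ← le_div_iff₀ (hWpos z hz)]
      exact h.trans (csInf_le hbdd ⟨_, hV z hz, rfl⟩)
    set x : ℝ → ℝ := fun z => Q ((σ - 1) * z ^ (σ - 1)) / z with hxdef
    set g : ℝ → ℝ := fun z => σ / (σ - 1) ^ 2 *
      (((σ - 1) * z ^ (σ - 1) * Q ((σ - 1) * z ^ (σ - 1)) - t (Q ((σ - 1) * z ^ (σ - 1)))) / z ^ σ)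
      with hgdef
    have hQx (z : ℝ) (hz : 0 < z) : Q ((σ - 1) * z ^ (σ - 1)) = z * x z := by
      simp only [hxdef]
      field_simp
    have htg (z : ℝ) (hz : 0 < z) :
        t (z * x z) = (σ - 1) * z ^ σ * x z - (σ - 1) ^ 2 / σ * z ^ σ * g z := by
      have : 0 < z ^ (σ - 1) := by positivity
      simp only [hgdef, hQx z hz, hzσ z hz]
      field_simp
      ring
    have hx0 (z : ℝ) (hz : 0 < z) : 0 ≤ x z := div_nonneg (hQ _ (hV z hz)).1 hz.le
    have hg0 (z : ℝ) (hz : 0 < z) : 0 ≤ g z := by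
      have := (hQ _ (hV z hz)).2.1 0 self_mem_Ici
      simp only [mul_zero, ht0, sub_zero] at this
      simp only [hgdef]
      positivity
    have hgx (z : ℝ) (hz : 0 < z) :
        g z + 1 / (σ * (σ - 1)) * (x z ^ σ - (1 + σ * (x z - 1))) ≤ x z := by
      have hp := hprofit z hz
      rw [hQx z hz, htg z hz, hc, Real.mul_rpow hz.le (hx0 z hz)] at hp
      have hpos : 0 < (σ - 1) ^ 2 / σ * z ^ σ := by positivity
      rw [← mul_le_mul_iff_right₀ hpos, ← sub_nonneg]
      refine (sub_nonneg.2 hp).trans_eq ?_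
      field_simp
      ring
    have hgC (z : ℝ) (hz : 0 < z) : g z ≤ σ ^ (σ - 1)⁻¹ := by
      have hs0 : 0 < σ ^ (σ - 1)⁻¹ := by positivity
      have hs : (σ ^ (σ - 1)⁻¹) ^ σ = σ * σ ^ (σ - 1)⁻¹ := by
        rw [hzσ _ hs0, Real.rpow_inv_rpow hσ0.le hσ1.ne']
      generalize σ ^ (σ - 1)⁻¹ = s at hs0 hs ⊢
      have htan := mul_le_mul_of_nonneg_left
        (tangent_le_rpow hσ (div_nonneg (hx0 z hz) hs0.le)) (by positivity : 0 ≤ s ^ σ)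
      rw [← Real.mul_rpow hs0.le (div_nonneg (hx0 z hz) hs0.le), mul_div_cancel₀ _ hs0.ne',
        hs] at htan
      have hD := mul_le_mul_of_nonneg_left (sub_le_sub_right htan (1 + σ * (x z - 1)))
        (by positivity : 0 ≤ 1 / (σ * (σ - 1)))
      have e : 1 / (σ * (σ - 1)) * (σ * s * (1 + σ * (x z / s - 1)) - (1 + σ * (x z - 1))) =
          x z - s + 1 / σ := by
        field_simp
        ring
      have : 0 < 1 / σ := by positivity
      linarith [hgx z hz]
    have hsupp (z : ℝ) (hz : 0 < z) (l : ℝ) (hl : 1 < l) :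
        g z + x z * (σ / (σ - 1) * (l ^ (σ - 1) - 1)) ≤ l ^ σ * g (l * z) := by
      have hl0 : 0 < l := by linarith
      have hlz : 0 < l * z := mul_pos hl0 hz
      have hm := (hQ _ (hV _ hlz)).2.1 (z * x z) (mul_nonneg hz.le (hx0 z hz))
      simp only [hQx _ hlz, htg _ hlz, htg z hz] at hm
      have hpos : 0 < (σ - 1) ^ 2 / σ * z ^ σ := by positivity
      rw [← mul_le_mul_iff_right₀ hpos, ← sub_nonneg]
      refine (sub_nonneg.2 hm).trans_eq ?_
      rw [Real.mul_rpow hl0.le hz.le, Real.mul_rpow hl0.le hz.le, hzσ z hz, hzσ l hl0]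
      field_simp
      ring
    have hone := eq_one_of_support hσ (by positivity) hx0 hg0 hgC hgx hsupp
    intro q hq
    rcases hq.eq_or_lt with rfl | hq
    · rw [ht0, hc, Real.zero_rpow hσ0.ne']
      ring
    · have := htg q hq
      rw [(hone q hq).1, (hone q hq).2, mul_one] at this
      rw [this, hc]
      field_simp
      ring
  refine ⟨?_, fun h => unique h.ge, attained⟩
  by_contra! h
  exact h.ne' (attained (unique h.le))
end
end

section
/- Let σ ∈ (0,1), u(q) = q^σ/σ, and B̂(σ) = ( σ^{−σ/(1−σ)} − σ − ln(1−σ) )^{−1}. Let F* be the probability measure on [0,σ] with density B̂(σ)/(1−z) on [0,σ) and a point mass of size 1 + B̂(σ)·ln(1−σ) at z = σ. Then the randomization over constant share mechanisms according to F* guarantees the fraction B̂(σ) of the efficient social surplus: for every cost function c ∈ C_cx, ∫_{[0,σ]} U(c,z) dF*(z) ≥ B̂(σ) · W(c). -/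
open Real Set MeasureTheory

noncomputable section

/-- If the increments of `P` are bounded by `(b - a) * g b` for a monotone `g`, then the total
increment of `P` is at most the integral of `g`. -/
theorem sub_le_integral_of_increment_le {g P : ℝ → ℝ} {s : ℝ} (hs : 0 < s)
    (hg : MonotoneOn g (Icc 0 s))
    (hP : ∀ a b, 0 ≤ a → a ≤ b → b ≤ s → P b - P a ≤ (b - a) * g b) :
    P s - P 0 ≤ ∫ z in (0:ℝ)..s, g z := by
  have key : ∀ n : ℕ, P s - P 0 ≤ (∫ z in (0:ℝ)..s, g z) + s * (g s - g 0) / ((n:ℝ) + 1) := by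
    intro n
    have hn : (0:ℝ) < (n:ℝ) + 1 := by positivity
    set d : ℝ := s / ((n:ℝ) + 1) with hd
    have hd0 : 0 < d := by positivity
    have hds : d * ((n:ℝ) + 1) = s := by rw [hd]; field_simp
    have hmono : MonotoneOn (fun t => g (d * t)) (Icc (0:ℝ) (0 + ((n + 1 : ℕ) : ℝ))) := by
      intro x hx y hy hxy
      simp only [zero_add, Nat.cast_add, Nat.cast_one, mem_Icc] at hx hy
      refine hg ⟨mul_nonneg hd0.le hx.1, ?_⟩ ⟨mul_nonneg hd0.le hy.1, ?_⟩
        (mul_le_mul_of_nonneg_left hxy hd0.le)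
      · rw [← hds]; exact mul_le_mul_of_nonneg_left hx.2 hd0.le
      · rw [← hds]; exact mul_le_mul_of_nonneg_left hy.2 hd0.le
    have hsum := hmono.sum_le_integral
    simp only [zero_add] at hsum
    rw [intervalIntegral.integral_comp_mul_left _ hd0.ne'] at hsum
    push_cast at hsum
    rw [hds, mul_zero, smul_eq_mul, inv_mul_eq_div, le_div_iff₀ hd0] at hsum
    have htel : P s - P 0 ≤ ∑ i ∈ Finset.range (n + 1), d * g (d * ((i + 1 : ℕ) : ℝ)) := by
      have h1 := Finset.sum_range_sub (fun i : ℕ => P (d * (i : ℝ))) (n + 1)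
      simp only [Nat.cast_zero, mul_zero] at h1
      push_cast at h1
      rw [hds] at h1
      rw [← h1]
      refine Finset.sum_le_sum fun i hi => ?_
      have hi' : (i:ℝ) + 1 ≤ (n:ℝ) + 1 := by
        have := Finset.mem_range.1 hi
        exact_mod_cast this
      have := hP (d * i) (d * (i + 1)) (by positivity) (by nlinarith)
        (by rw [← hds]; exact mul_le_mul_of_nonneg_left hi' hd0.le)
      push_cast
      calc _ ≤ _ := this
        _ = _ := by ring
    have hshift : ∑ i ∈ Finset.range (n + 1), g (d * ((i + 1 : ℕ) : ℝ))
        = (∑ i ∈ Finset.range (n + 1), g (d * (i : ℝ))) + g s - g 0 := by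
      have h1 := Finset.sum_range_sub (fun i : ℕ => g (d * (i : ℝ))) (n + 1)
      rw [Finset.sum_sub_distrib] at h1
      simp only [Nat.cast_zero, mul_zero] at h1
      have h2 : d * ((n + 1 : ℕ) : ℝ) = s := by push_cast; exact hds
      rw [h2] at h1
      linarith
    rw [← Finset.mul_sum, hshift] at htel
    have : s * (g s - g 0) / ((n:ℝ) + 1) = d * (g s - g 0) := by rw [hd]; ring
    rw [this]
    linarith
  have hlim : Filter.Tendsto (fun n : ℕ => (∫ z in (0:ℝ)..s, g z) + s * (g s - g 0) / ((n:ℝ) + 1))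
      Filter.atTop (nhds ((∫ z in (0:ℝ)..s, g z) + 0)) := by
    refine Filter.Tendsto.const_add _ ?_
    exact (tendsto_const_nhds.div_atTop
      (Filter.tendsto_atTop_add_const_right _ _ tendsto_natCast_atTop_atTop))
  rw [add_zero] at hlim
  exact ge_of_tendsto' hlim key

/-- A maximizer of `h - c` on `[0, ∞)`, with `c` convex with `c 0 = 0` and `h = q ^ σ`, is
positive, because the marginal value of `q ^ σ` at `0` is infinite. -/
theorem pos_of_isMaxOn_rpow_sub_convex {σ : ℝ} (h0 : 0 < σ) (h1 : σ < 1) {c : ℝ → ℝ}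
    (hc : ConvexOn ℝ (Ici 0) c) (hc0 : c 0 = 0) {p : ℝ} (hp : 0 ≤ p)
    (hmax : ∀ x, 0 ≤ x → x ^ σ - c x ≤ p ^ σ - c p) : 0 < p := by
  refine lt_of_le_of_ne hp fun hp0 => ?_
  subst hp0
  rw [hc0, Real.zero_rpow h0.ne'] at hmax
  have hle : ∀ x, 0 < x → x ≤ 1 → 1 ≤ x ^ (1 - σ) * c 1 := by
    intro x hx hx1
    have hconv := hc.2 (x := 0) (y := 1) (by simp) (by simp) (sub_nonneg.2 hx1) hx.le (by ring)
    simp only [smul_eq_mul, mul_zero, mul_one, zero_add, hc0] at hconv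
    have hm := hmax x hx.le
    have hxx : x ^ (1 - σ) * x ^ σ = x := by
      rw [← Real.rpow_add hx]; simp
    have hpos : 0 < x ^ σ := Real.rpow_pos_of_pos hx _
    have : x ^ σ * 1 ≤ x ^ σ * (x ^ (1 - σ) * c 1) := by
      calc x ^ σ * 1 ≤ x * c 1 := by linarith
        _ = _ := by nth_rewrite 1 [← hxx]; ring
    exact le_of_mul_le_mul_left this hpos
  have hlim : Filter.Tendsto (fun x : ℝ => x ^ (1 - σ) * c 1) (nhdsWithin 0 (Ioi 0))
      (nhds ((0:ℝ) ^ (1 - σ) * c 1)) :=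
    (((Real.continuousAt_rpow_const 0 (1 - σ) (Or.inr (by linarith))).tendsto).mul_const
      _).mono_left nhdsWithin_le_nhds
  have := ge_of_tendsto hlim (b := 1) (by
    filter_upwards [Ioc_mem_nhdsGT (zero_lt_one' ℝ)] with x hx using hle x hx.1 hx.2)
  rw [Real.zero_rpow (by linarith)] at this
  linarith

/-- First-order condition: at a positive maximizer `p` of `q ^ σ - c q` on `[0, ∞)` with `c`
convex, the derivative of `q ^ σ` is a subgradient of `c`. -/
theorem subgradient_of_isMaxOn_rpow_sub_convex {σ : ℝ} {c : ℝ → ℝ}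
    (hc : ConvexOn ℝ (Ici 0) c) {p : ℝ} (hp : 0 < p)
    (hmax : ∀ x, 0 ≤ x → x ^ σ - c x ≤ p ^ σ - c p) {q : ℝ} (hq : 0 ≤ q) :
    c p + σ * p ^ (σ - 1) * (q - p) ≤ c q := by
  have hline : HasDerivAt (fun t : ℝ => p + t * (q - p)) (q - p) 0 := by
    simpa using ((hasDerivAt_id (0:ℝ)).mul_const (q - p)).const_add p
  have hder : HasDerivAt (fun t : ℝ => (p + t * (q - p)) ^ σ) ((q - p) * σ * p ^ (σ - 1)) 0 := by
    simpa using hline.rpow_const (p := σ) (Or.inl (by simpa using hp.ne'))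
  have hs := hder.tendsto_slope_zero_right
  have : (q - p) * σ * p ^ (σ - 1) ≤ c q - c p := by
    refine le_of_tendsto hs ?_
    filter_upwards [Ioc_mem_nhdsGT (zero_lt_one' ℝ)] with t ht
    have hx : 0 ≤ p + t * (q - p) := by nlinarith [ht.1, ht.2]
    have hm := hmax _ hx
    have hconv := hc.2 (x := p) (y := q) hp.le hq (sub_nonneg.2 ht.2) ht.1.le (by ring)
    simp only [smul_eq_mul] at hconv
    rw [show (1 - t) * p + t * q = p + t * (q - p) by ring] at hconv
    simp only [zero_add, zero_mul, add_zero, smul_eq_mul]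
    rw [inv_mul_le_iff₀ ht.1]
    linarith
  linarith

/-- The indirect surplus of the isoelastic utility against the linear price `σ * p ^ (σ - 1)`. -/
theorem rpow_div_sub_linear_le {σ : ℝ} (h0 : 0 < σ) (h1 : σ < 1) {p q : ℝ} (hp : 0 < p)
    (hq : 0 ≤ q) :
    q ^ σ / σ - σ * p ^ (σ - 1) * q ≤ (1 - σ) / σ * (σ ^ (-(σ / (1 - σ))) * p ^ σ) := by
  have hσ' : 1 - σ ≠ 0 := by linarith
  set r : ℝ := p * σ ^ (-(1 / (1 - σ))) with hr
  have hσr : 0 < σ ^ (-(1 / (1 - σ))) := Real.rpow_pos_of_pos h0 _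
  have hr0 : 0 < r := mul_pos hp hσr
  have hr1 : r ^ (σ - 1) = p ^ (σ - 1) * σ := by
    rw [hr, Real.mul_rpow hp.le hσr.le, ← Real.rpow_mul h0.le]
    rw [show -(1 / (1 - σ)) * (σ - 1) = 1 by field_simp; ring, Real.rpow_one]
  have hr2 : r ^ σ = σ ^ (-(σ / (1 - σ))) * p ^ σ := by
    rw [hr, Real.mul_rpow hp.le hσr.le, ← Real.rpow_mul h0.le, mul_comm]
    congr 2
    ring
  have hag := Real.geom_mean_le_arith_mean2_weighted h0.le (by linarith : 0 ≤ 1 - σ) hq hr0.le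
    (by ring)
  have hrr : r ^ (1 - σ) * r ^ (σ - 1) = 1 := by rw [← Real.rpow_add hr0]; simp
  have hrs : r * r ^ (σ - 1) = r ^ σ := by
    rw [mul_comm, ← Real.rpow_add_one hr0.ne']; simp
  have h := mul_le_mul_of_nonneg_right hag (Real.rpow_pos_of_pos hr0 (σ - 1)).le
  have hle : q ^ σ ≤ σ * q * (p ^ (σ - 1) * σ) + (1 - σ) * r ^ σ := by
    calc q ^ σ = q ^ σ * r ^ (1 - σ) * r ^ (σ - 1) := by rw [mul_assoc, hrr, mul_one]
      _ ≤ _ := h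
      _ = σ * q * r ^ (σ - 1) + (1 - σ) * (r * r ^ (σ - 1)) := by ring
      _ = _ := by rw [hrs, hr1]
  rw [← hr2, sub_le_iff_le_add, div_le_iff₀ h0]
  calc q ^ σ ≤ _ := hle
    _ = _ := by field_simp; ring

/-- The integral against a density on `[0, s)` plus an atom at `s`. -/
theorem integral_density_add_atom {s m B : ℝ} (hs : 0 < s) (hs1 : s < 1) (hB : 0 ≤ B)
    (hm : 0 ≤ m) {f g : ℝ → ℝ} (hg : MonotoneOn g (Icc 0 s))
    (hfg : ∀ z ∈ Ioc 0 s, f z = (1 - z) * g z) :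
    ∫ z, f z ∂((volume.restrict (Ico 0 s)).withDensity
        (fun z => ENNReal.ofReal (B / (1 - z))) + ENNReal.ofReal m • Measure.dirac s) =
      B * (∫ z in (0:ℝ)..s, g z) + m * f s := by
  have hmeas : Measurable (fun z : ℝ => ENNReal.ofReal (B / (1 - z))) := by fun_prop
  have hgi : IntegrableOn g (Ico 0 s) :=
    (hg.integrableOn_isCompact isCompact_Icc).mono_set Ico_subset_Icc_self
  have hae : (fun z => (ENNReal.ofReal (B / (1 - z))).toReal • f z)
      =ᵐ[volume.restrict (Ico 0 s)] fun z => B * g z := by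
    have hne : ∀ᵐ z ∂(volume.restrict (Ico 0 s)), z ≠ 0 :=
      ae_restrict_of_ae (Measure.ae_ne volume 0)
    filter_upwards [hne, ae_restrict_mem measurableSet_Ico] with z hz hzm
    have hz1 : 0 < 1 - z := by linarith [hzm.2]
    rw [hfg z ⟨lt_of_le_of_ne hzm.1 hz.symm, hzm.2.le⟩, ENNReal.toReal_ofReal (by positivity),
      smul_eq_mul]
    field_simp
  have htop : ∀ᵐ z ∂(volume.restrict (Ico 0 s)), ENNReal.ofReal (B / (1 - z)) < ⊤ :=
    Filter.Eventually.of_forall fun _ => ENNReal.ofReal_lt_top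
  have hfd : Integrable f ((volume.restrict (Ico 0 s)).withDensity
      (fun z => ENNReal.ofReal (B / (1 - z)))) := by
    rw [integrable_withDensity_iff_integrable_smul' hmeas htop, integrable_congr hae]
    exact hgi.const_mul B
  have hfa : Integrable f (ENNReal.ofReal m • Measure.dirac s) :=
    (integrable_dirac (by simp)).smul_measure ENNReal.ofReal_ne_top
  rw [integral_add_measure hfd hfa, integral_withDensity_eq_integral_toReal_smul hmeas htop,
    integral_congr_ae hae, integral_const_mul, integral_smul_measure, integral_dirac,
    ENNReal.toReal_ofReal hm, smul_eq_mul, intervalIntegral.integral_of_le hs.le,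
    integral_Ico_eq_integral_Ioc]

/-- Proposition 5, guarantee of the randomized constant share
mechanism.  For `σ ∈ (0,1)`, `u(q) = q^σ/σ`, and
`B̂(σ) = (σ^{−σ/(1−σ)} − σ − ln(1−σ))⁻¹`, let `F*` be the probability measure on `[0,σ]`
with density `B̂(σ)/(1−z)` on `[0,σ)` and an atom of mass `1 + B̂(σ)·ln(1−σ)` at `σ`.
Then randomizing the share `z` according to `F*` guarantees the fraction `B̂(σ)` of the
efficient social surplus: for every `c ∈ C_cx`,
`∫ (1−z)·u(q(c,z)) dF*(z) ≥ B̂(σ)·W(c)`. -/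
theorem stmt_14 (σ : ℝ) (hσ : σ ∈ Ioo (0:ℝ) 1)
    (u : ℝ → ℝ) (hu : ∀ q, u q = q ^ σ / σ)
    (Bhat : ℝ) (hBhat : Bhat = (σ ^ (-(σ / (1 - σ))) - σ - Real.log (1 - σ))⁻¹)
    (F : Measure ℝ)
    (hF : F = (volume.restrict (Ico 0 σ)).withDensity
        (fun z => ENNReal.ofReal (Bhat / (1 - z))) +
      (ENNReal.ofReal (1 + Bhat * Real.log (1 - σ))) • Measure.dirac σ)
    (W : (ℝ → ℝ) → ℝ) (hW : ∀ c, W c = sSup {x | ∃ q ≥ (0:ℝ), x = u q - c q})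
    (c : ℝ → ℝ) (hc : CostCcx c)
    (Q : ℝ → ℝ)
    (hQ : ∀ z ∈ Ioc (0:ℝ) σ, IsSmallestArgmaxOn (fun q => z * u q - c q) (Ici 0) (Q z)) :
    Bhat * W c ≤ ∫ z, (1 - z) * u (Q z) ∂F := by
  obtain ⟨h0, h1⟩ := hσ
  obtain ⟨hcnn, -, hconv, hc0, -⟩ := hc
  have hu0 : u 0 = 0 := by rw [hu, Real.zero_rpow h0.ne', zero_div]
  set A : ℝ := σ ^ (-(σ / (1 - σ))) with hA
  have hA1 : 1 ≤ A := by
    refine Real.one_le_rpow_of_pos_of_le_one_of_nonpos h0 h1.le (neg_nonpos.2 ?_)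
    exact div_nonneg h0.le (by linarith)
  have hlog : Real.log (1 - σ) < 0 := Real.log_neg (by linarith) (by linarith)
  have hD : 0 < A - σ - Real.log (1 - σ) := by linarith
  have hB : 0 < Bhat := by rw [hBhat]; exact inv_pos.2 hD
  have hBD : Bhat * (A - σ - Real.log (1 - σ)) = 1 := by rw [hBhat]; exact inv_mul_cancel₀ hD.ne'
  have hm : 1 + Bhat * Real.log (1 - σ) = Bhat * (A - σ) := by linear_combination -hBD
  have hm0 : 0 ≤ 1 + Bhat * Real.log (1 - σ) := by
    rw [hm]; exact mul_nonneg hB.le (by linarith)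
  -- extend the supply to the share `0`
  set R : ℝ → ℝ := fun z => if z = 0 then 0 else Q z with hR
  have hR0 : R 0 = 0 := by simp [hR]
  have hRQ : ∀ z ∈ Ioc 0 σ, R z = Q z := fun z hz => by simp [hR, hz.1.ne']
  have hRnn : ∀ z ∈ Icc 0 σ, 0 ≤ R z := by
    intro z hz
    rcases hz.1.eq_or_lt with rfl | hz0
    · rw [hR0]
    · rw [hRQ z ⟨hz0, hz.2⟩]; exact (hQ z ⟨hz0, hz.2⟩).1
  have hopt : ∀ z ∈ Icc 0 σ, ∀ x, 0 ≤ x → z * u x - c x ≤ z * u (R z) - c (R z) := by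
    intro z hz x hx
    rcases hz.1.eq_or_lt with rfl | hz0
    · rw [hR0, hc0]; linarith [hcnn x hx]
    · rw [hRQ z ⟨hz0, hz.2⟩]; exact (hQ z ⟨hz0, hz.2⟩).2.1 x hx
  have hmono : MonotoneOn (fun z => u (R z)) (Icc 0 σ) := by
    intro a ha b hb hab
    rcases hab.eq_or_lt with rfl | hlt
    · exact le_rfl
    have e1 := hopt a ha _ (hRnn b hb)
    have e2 := hopt b hb _ (hRnn a ha)
    by_contra! hcon
    nlinarith [mul_pos (sub_pos.2 hlt) (sub_pos.2 hcon)]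
  have henv := sub_le_integral_of_increment_le (g := fun z => u (R z))
    (P := fun z => z * u (R z) - c (R z)) h0 hmono (by
      intro a b ha hab hb
      have := hopt a ⟨ha, hab.trans hb⟩ _ (hRnn b ⟨ha.trans hab, hb⟩)
      linarith)
  have hσm : σ ∈ Ioc (0:ℝ) σ := ⟨h0, le_rfl⟩
  simp only [hR0, hc0, hRQ σ hσm, zero_mul, sub_zero] at henv
  set p : ℝ := Q σ with hp
  have hσu : ∀ x, σ * u x = x ^ σ := fun x => by rw [hu]; field_simp
  have hmax : ∀ x, 0 ≤ x → x ^ σ - c x ≤ p ^ σ - c p := fun x hx => by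
    simpa only [hσu] using (hQ σ hσm).2.1 x hx
  have hp0 : 0 < p := pos_of_isMaxOn_rpow_sub_convex h0 h1 hconv hc0 (hQ σ hσm).1 hmax
  have hpp : p ^ (σ - 1) * p = p ^ σ := by rw [← Real.rpow_add_one hp0.ne']; simp
  have hWle : W c ≤ σ * u p - c p + (1 - σ) * (A - σ) * u p := by
    rw [hW]
    refine csSup_le ⟨u 0 - c 0, 0, le_rfl, rfl⟩ ?_
    rintro _ ⟨q, hq, rfl⟩
    have e1 := subgradient_of_isMaxOn_rpow_sub_convex hconv hp0 hmax hq
    have e2 := rpow_div_sub_linear_le h0 h1 hp0 hq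
    rw [← hu, ← hA] at e2
    have e3 : (1 - σ) / σ * (A * p ^ σ) = (1 - σ) * A * u p := by rw [hu]; ring
    have e4 : σ * p ^ (σ - 1) * (q - p) = σ * p ^ (σ - 1) * q - σ * (σ * u p) := by
      rw [hσu, ← hpp]; ring
    linarith
  have hfd := integral_density_add_atom (f := fun z => (1 - z) * u (Q z)) h0 h1 hB.le hm0 hmono
    (fun z hz => by simp only [hRQ z hz])
  rw [hF, hfd, hm]
  calc Bhat * W c ≤ Bhat * (σ * u p - c p + (1 - σ) * (A - σ) * u p) :=
        mul_le_mul_of_nonneg_left hWle hB.le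
    _ = Bhat * (σ * u p - c p) + Bhat * (A - σ) * ((1 - σ) * u p) := by ring
    _ ≤ _ := by gcongr
end
end
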